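/- Let Γ be a commutative thick weakly distance-regular digraph. If p^{(1,q-1)}_{(1,s-1),(1,t-1)} ≠ 0 with s ≠ t, then q ∈ {s,t}. -/

import Mathlib

/-!
Common framework: commutative thick weakly distance-regular digraphs.
-/

variable {V : Type*}

/-- There is a directed walk of length `n` from `x` to `y`. -/
def HasWalk (adj : V → V → Prop) (x y : V) (n : ℕ) : Prop :=
  ∃ f : ℕ → V, f 0 = x ∧ f n = y ∧ ∀ i < n, adj (f i) (f (i + 1))

/-- Directed distance `∂(x,y)`. -/
noncomputable def ddist (adj : V → V → Prop) (x y : V) : ℕ :=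
  sInf {n | HasWalk adj x y n}

/-- Two-way distance `∂̃(x,y) = (∂(x,y), ∂(y,x))`. -/
noncomputable def tdist (adj : V → V → Prop) (x y : V) : ℕ × ℕ :=
  (ddist adj x y, ddist adj y x)

/-- The pair `i` is an attained two-way distance, i.e. `i ∈ ∂̃(Γ)`. -/
def Attained (adj : V → V → Prop) (i : ℕ × ℕ) : Prop :=
  ∃ x y : V, tdist adj x y = i

/-- Intersection number `p^h_{i,j}`: for attained `h` it is the common cardinality of
`{z | ∂̃(x,z) = i, ∂̃(z,y) = j}` over pairs with `∂̃(x,y) = h` (and `0` otherwise). -/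
noncomputable def pnum (adj : V → V → Prop) (h i j : ℕ × ℕ) : ℕ :=
  sSup {n | ∃ x y : V, tdist adj x y = h ∧
    n = Set.ncard {z : V | tdist adj x z = i ∧ tdist adj z y = j}}

/-- Valency `k_i = |Γ_i(x)|`. -/
noncomputable def kval (adj : V → V → Prop) (i : ℕ × ℕ) : ℕ :=
  pnum adj (0, 0) i i.swap

/-- Adjacency of the subdigraph `Δ_J`: arcs of type `(1, t-1)` for `t ∈ J`. -/
def deltaAdj (adj : V → V → Prop) (J : Set ℕ) (u v : V) : Prop :=
  ∃ t ∈ J, tdist adj u v = (1, t - 1)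

/-- A circuit of length `s`. -/
def IsCircuit (adj : V → V → Prop) (s : ℕ) (f : ℕ → V) : Prop :=
  0 < s ∧ f s = f 0 ∧ ∀ i < s, adj (f i) (f (i + 1))

/-- Strongly connected. -/
def IsStrong (adj : V → V → Prop) : Prop :=
  ∀ x y : V, ∃ n, HasWalk adj x y n

/-- Weakly distance-regular: the intersection numbers are well defined. -/
def IsWDR (adj : V → V → Prop) : Prop :=
  ∀ (i j : ℕ × ℕ) (x y x' y' : V), tdist adj x y = tdist adj x' y' →
    Set.ncard {z : V | tdist adj x z = i ∧ tdist adj z y = j}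
      = Set.ncard {z : V | tdist adj x' z = i ∧ tdist adj z y' = j}

/-- Thick: `p^h_{i,i}, p^h_{i,i*} ∈ {0, k_i}`. -/
def IsThick (adj : V → V → Prop) : Prop :=
  ∀ h i : ℕ × ℕ,
    (pnum adj h i i = 0 ∨ pnum adj h i i = kval adj i) ∧
    (pnum adj h i i.swap = 0 ∨ pnum adj h i i.swap = kval adj i)

/-- A thick weakly distance-regular digraph (as a property of an adjacency relation). -/
def IsWDRThick (adj : V → V → Prop) : Prop :=
  IsStrong adj ∧ IsWDR adj ∧ IsThick adj

/-- A commutative thick weakly distance-regular digraph. -/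
structure CTWDR (V : Type*) [Fintype V] where
  adj : V → V → Prop
  loopless : ∀ v, ¬ adj v v
  strong : IsStrong adj
  wdr : IsWDR adj
  comm : ∀ (i j : ℕ × ℕ) (x y : V),
    Set.ncard {z : V | tdist adj x z = i ∧ tdist adj z y = j}
      = Set.ncard {z : V | tdist adj x z = j ∧ tdist adj z y = i}
  thick : IsThick adj

namespace CTWDR

variable {V : Type*} [Fintype V] (G : CTWDR V)

/-- Product `EF` of two sets of relations (relations identified with two-way distances). -/
def prodS (E F : Set (ℕ × ℕ)) : Set (ℕ × ℕ) :=
  {h | ∃ i ∈ E, ∃ j ∈ F, pnum G.adj h i j ≠ 0}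

/-- Powers `Γ_i^l` (with `Γ_i^0 = {Γ_{(0,0)}}` and `Γ_i^1 = {Γ_i}`). -/
def pow (i : ℕ × ℕ) : ℕ → Set (ℕ × ℕ)
  | 0 => {(0, 0)}
  | 1 => {i}
  | n + 2 => G.prodS (pow i (n + 1)) {i}

/-- The pair `(1, s-1)` is pure: every circuit of length `s` containing an arc of type
`(1, s-1)` consists of arcs of type `(1, s-1)`. -/
def Pure (s : ℕ) : Prop :=
  ∀ f : ℕ → V, IsCircuit G.adj s f →
    (∃ i < s, tdist G.adj (f i) (f (i + 1)) = (1, s - 1)) →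
    ∀ i < s, tdist G.adj (f i) (f (i + 1)) = (1, s - 1)

/-- `(1, s-1)` is mixed. -/
def Mixed (s : ℕ) : Prop := ¬ G.Pure s

/-- Configuration `C(q)` exists. -/
def Cexists (q : ℕ) : Prop :=
  pnum G.adj (1, q - 2) (1, q - 1) (1, q - 1) ≠ 0 ∧ G.Pure (q - 1)

/-- Configuration `D(q)` exists. -/
def Dexists (q : ℕ) : Prop :=
  pnum G.adj (1, q - 1) (1, q - 2) (q - 2, 1) ≠ 0 ∧ G.Pure (q - 1)

/-- A closed set of relations: `Γ_{i*}Γ_j ⊆ F` for all `i, j ∈ F`. -/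
def Closed (F : Set (ℕ × ℕ)) : Prop :=
  ∀ i ∈ F, ∀ j ∈ F, G.prodS {i.swap} {j} ⊆ F

/-- The minimal closed set `⟨F⟩` containing `F`. -/
def genClosed (F : Set (ℕ × ℕ)) : Set (ℕ × ℕ) :=
  ⋂₀ {C | F ⊆ C ∧ G.Closed C}

/-- The block `F_J(x)` of the closed set generated by `{Γ_{1,t-1}}_{t ∈ J}`. -/
def block (J : Set ℕ) (x : V) : Set V :=
  {y | tdist G.adj x y ∈ G.genClosed {i | ∃ t ∈ J, i = (1, t - 1)}}

end CTWDR

set_option linter.unusedSectionVars false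

/-- Abstract commutative thick hypergroup of relations with a length function. -/
class Hyp (R : Type*) where
  m : R → R → R → Prop
  o : R
  st : R → R
  len : R → ℕ
  m_comm : ∀ {a b h}, m a b h → m b a h
  m_assoc : ∀ {a b c h k}, m a b h → m h c k → ∃ u, m b c u ∧ m a u k
  one_m : ∀ {a h}, m o a h ↔ h = a
  st_st : ∀ a, st (st a) = a
  rot : ∀ {a b h}, m a b h → m h (st b) a
  thick : ∀ {a e h}, m a (st a) e → m a e h → h = a
  ex : ∀ a b, ∃ h, m a b h
  len_add : ∀ {a b h}, m a b h → len h ≤ len a + len b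
  len_o : len o = 0
  len_zero : ∀ {a}, len a = 0 → a = o
  len_succ : ∀ {h n}, len h = n + 1 → ∃ g k, len g = 1 ∧ len k = n ∧ m g k h
  lext : ∀ {a b}, len a = len b → len (st a) = len (st b) → a = b

namespace Hyp

/-- Sets of relations. -/
def M (R : Type*) := Set R

variable {R : Type*} [Hyp R]

instance : PartialOrder (M R) := inferInstanceAs (PartialOrder (Set R))
instance : Membership R (M R) := inferInstanceAs (Membership R (Set R))

theorem le_def {S T : M R} : S ≤ T ↔ ∀ h, h ∈ S → h ∈ T := Iff.rfl

@[ext] theorem M_ext {S T : M R} (h : ∀ x, x ∈ S ↔ x ∈ T) : S = T := Set.ext h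

/-- Singleton. -/
def s (a : R) : M R := ({a} : Set R)

theorem mem_s {a b : R} : a ∈ s b ↔ a = b := Iff.rfl

theorem s_le {a : R} {S : M R} : s a ≤ S ↔ a ∈ S := Set.singleton_subset_iff

theorem s_le_s {a b : R} : s a ≤ s b ↔ a = b := by rw [s_le, mem_s]

instance : Mul (M R) := ⟨fun S T => ({h | ∃ a b, a ∈ S ∧ b ∈ T ∧ m a b h} : Set R)⟩
instance : One (M R) := ⟨s o⟩
instance : Add (M R) := ⟨fun S T => ({h | h ∈ S ∨ h ∈ T} : Set R)⟩
instance : Zero (M R) := ⟨(∅ : Set R)⟩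

theorem mem_mul {S T : M R} {h : R} : h ∈ S * T ↔ ∃ a b, a ∈ S ∧ b ∈ T ∧ m a b h := Iff.rfl
theorem mem_add {S T : M R} {h : R} : h ∈ S + T ↔ h ∈ S ∨ h ∈ T := Iff.rfl
theorem one_eq : (1 : M R) = s o := rfl
theorem mem_zero {h : R} : h ∈ (0 : M R) ↔ False := Iff.rfl

theorem mul_comm_M (S T : M R) : S * T = T * S := by
  ext h
  simp only [mem_mul]
  constructor <;> rintro ⟨a, b, ha, hb, hm⟩ <;> exact ⟨b, a, hb, ha, m_comm hm⟩

theorem assoc_le (S T U : M R) : S * T * U ≤ S * (T * U) := by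
  rintro k ⟨h, c, ⟨a, b, ha, hb, hm⟩, hc, hk⟩
  obtain ⟨u, h1, h2⟩ := m_assoc hm hk
  exact ⟨a, u, ha, ⟨b, c, hb, hc, h1⟩, h2⟩

theorem mul_assoc_M (S T U : M R) : S * T * U = S * (T * U) := by
  apply le_antisymm (assoc_le S T U)
  rw [mul_comm_M S (T * U), mul_comm_M T U, mul_comm_M (S * T) U, mul_comm_M S T]
  exact assoc_le _ _ _

theorem one_mul_M (S : M R) : 1 * S = S := by
  ext h
  rw [mem_mul]
  constructor
  · rintro ⟨a, b, ha, hb, hm⟩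
    rw [one_eq, mem_s] at ha
    subst ha
    rw [one_m] at hm
    exact hm ▸ hb
  · intro hh
    exact ⟨o, h, rfl, hh, one_m.2 rfl⟩

theorem mul_add_M (S T U : M R) : S * (T + U) = S * T + S * U := by
  ext h
  simp only [mem_mul, mem_add]
  constructor
  · rintro ⟨a, b, ha, hb | hb, hm⟩
    · exact Or.inl ⟨a, b, ha, hb, hm⟩
    · exact Or.inr ⟨a, b, ha, hb, hm⟩
  · rintro (⟨a, b, ha, hb, hm⟩ | ⟨a, b, ha, hb, hm⟩)
    · exact ⟨a, b, ha, Or.inl hb, hm⟩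
    · exact ⟨a, b, ha, Or.inr hb, hm⟩

theorem zero_mul_M (S : M R) : 0 * S = 0 := by
  ext h
  rw [mem_mul]
  constructor
  · rintro ⟨a, b, ha, hb, hm⟩
    exact ha
  · intro hh
    exact hh.elim

instance : CommSemiring (M R) where
  add_assoc S T U := by ext h; simp only [mem_add, or_assoc]
  zero_add S := by ext h; simp only [mem_add, mem_zero, false_or]
  add_zero S := by ext h; simp only [mem_add, mem_zero, or_false]
  add_comm S T := by ext h; simp only [mem_add, or_comm]
  nsmul := nsmulRec
  mul_assoc := mul_assoc_M
  mul_comm := mul_comm_M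
  one_mul := one_mul_M
  mul_one S := by rw [mul_comm_M, one_mul_M]
  left_distrib := mul_add_M
  right_distrib S T U := by
    rw [mul_comm_M, mul_add_M, mul_comm_M U S, mul_comm_M U T]
  zero_mul := zero_mul_M
  mul_zero S := by rw [mul_comm_M, zero_mul_M]

theorem mono {S S' T T' : M R} (h : S ≤ S') (h' : T ≤ T') : S * T ≤ S' * T' := by
  rintro k ⟨a, b, ha, hb, hm⟩
  exact ⟨a, b, h ha, h' hb, hm⟩

theorem mem_ss {a b h : R} : h ∈ s a * s b ↔ m a b h := by
  rw [mem_mul]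
  constructor
  · rintro ⟨a', b', ha, hb, hm⟩
    rw [mem_s] at ha hb
    rw [← ha, ← hb]
    exact hm
  · intro hm
    exact ⟨a, b, rfl, rfl, hm⟩

theorem st_o : st (o : R) = o := by
  have : m (o : R) o o := one_m.2 rfl
  have := rot this
  rw [one_m] at this
  exact this.symm

theorem st_m {a b h : R} (hm : m a b h) : m (st a) (st b) (st h) :=
  m_comm (rot (m_comm (rot (m_comm (rot hm)))))

theorem st_inj {a b : R} (h : st a = st b) : a = b := by
  rw [← st_st a, h, st_st]

/-- `E a = a a*`. -/
def E (a : R) : M R := s a * s (st a)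

/-- return length -/
def r (a : R) : ℕ := len (st a)

theorem uniq {a b : R} (h1 : len a = len b) (h2 : r a = r b) : a = b := lext h1 h2

theorem r_st (a : R) : r (st a) = len a := by rw [r, st_st]

/-- rotation in order form -/
theorem rotl {a b h : R} (hh : s h ≤ s a * s b) : s a ≤ s h * s (st b) := by
  rw [s_le, mem_ss] at *
  exact rot hh

theorem rotr {a b h : R} (hh : s h ≤ s a * s b) : s b ≤ s h * s (st a) := by
  rw [mul_comm] at hh
  exact rotl hh

theorem one_le_E (a : R) : 1 ≤ E a := by
  rw [one_eq, E, s_le, mem_ss]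
  exact rot (one_m.2 rfl)

theorem sE (a : R) : s a * E a = s a := by
  apply le_antisymm
  · rintro h ⟨a', e, ha, he, hm⟩
    rw [mem_s] at ha
    subst ha
    rw [E, mem_ss] at he
    exact thick he hm
  · calc s a = s a * 1 := by ring
      _ ≤ s a * E a := mono le_rfl (one_le_E a)

theorem E_st (a : R) : E (st a) = E a := by rw [E, E, st_st, mul_comm]

theorem EE (a : R) : E a * E a = E a := by
  nth_rw 2 [E]
  rw [← mul_assoc, mul_comm (E a), sE]
  rfl

theorem E_pow (a : R) {n : ℕ} (hn : 1 ≤ n) : E a ^ n = E a := by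
  induction n, hn using Nat.le_induction with
  | base => simp
  | succ n hn ih => rw [pow_succ, ih, EE]

theorem one_le_iff {h : R} {S : M R} : 1 ≤ s h * S ↔ s (st h) ≤ S := by
  constructor
  · intro hh
    rw [one_eq, s_le] at hh
    obtain ⟨a, b, ha, hb, hm⟩ := hh
    rw [mem_s] at ha
    subst ha
    have := m_comm hm
    have := rot this
    rw [one_m] at this
    rw [this] at hb
    exact s_le.2 hb
  · intro hh
    exact (one_le_E h).trans (mono le_rfl hh)

theorem mul_elim {h : R} {S T : M R} (hh : s h ≤ S * T) :
    ∃ a b, s a ≤ S ∧ s b ≤ T ∧ s h ≤ s a * s b := by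
  obtain ⟨a, b, ha, hb, hm⟩ := s_le.1 hh
  exact ⟨a, b, s_le.2 ha, s_le.2 hb, s_le.2 (mem_ss.2 hm)⟩

theorem mul_elim_s {h a : R} {T : M R} (hh : s h ≤ s a * T) :
    ∃ b, s b ≤ T ∧ s h ≤ s a * s b := by
  obtain ⟨a', b, ha, hb, hm⟩ := mul_elim hh
  rw [s_le_s] at ha
  subst ha
  exact ⟨b, hb, hm⟩

/-- splitting a circuit -/
theorem split {S T : M R} (hh : 1 ≤ S * T) : ∃ h, s h ≤ S ∧ s (st h) ≤ T ∧ 1 ≤ s h * T := by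
  rw [one_eq] at hh
  obtain ⟨a, b, ha, hb, hm⟩ := mul_elim hh
  have : 1 ≤ s a * T := by rw [one_eq]; exact hm.trans (mono le_rfl hb)
  exact ⟨a, ha, one_le_iff.1 this, this⟩

theorem one_star {h : R} {S : M R} (hh : 1 ≤ s h * S) : s (st h) ≤ S := one_le_iff.1 hh

theorem coset {a b h : R} (hh : s h ≤ s a * s b) : s a * s b = s h * E b := by
  apply le_antisymm
  · calc s a * s b ≤ (s h * s (st b)) * s b := mono (rotl hh) le_rfl
      _ = s h * E b := by rw [E]; ring
  · calc s h * E b ≤ (s a * s b) * E b := mono hh le_rfl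
      _ = s a * (s b * E b) := by ring
      _ = s a * s b := by rw [sE]

theorem coset' {a b h : R} (hh : s h ≤ s a * s b) : s a * s b = s h * E a := by
  rw [mul_comm] at hh ⊢
  exact coset hh

theorem same {c g g' h : R} (h1 : s h ≤ s c * s g) (h2 : s h ≤ s c * s g') :
    s c * s g = s c * s g' := by rw [coset' h1, coset' h2]

theorem cancelE {c g g' : R} (h : s c * s g = s c * s g') : E c * s g = E c * s g' := by
  calc E c * s g = s (st c) * (s c * s g) := by rw [E]; ring
    _ = s (st c) * (s c * s g') := by rw [h]
    _ = E c * s g' := by rw [E]; ring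

theorem st_mem_E {h a : R} (hh : s h ≤ E a) : s (st h) ≤ E a := by
  rw [E, s_le, mem_ss] at *
  have := st_m hh
  rw [st_st] at this
  exact m_comm this

theorem E_iff {c d : R} : s c ≤ E d ↔ s d ≤ s d * s c := by
  constructor
  · intro h
    have h2 := rotl (h.trans_eq (show E d = s d * s (st d) from rfl))
    rw [st_st] at h2
    rw [mul_comm]
    exact h2
  · intro h
    exact rotr h

theorem absorb {c d : R} (h : s c ≤ E d) : s d * s c = s d := by
  apply le_antisymm
  · calc s d * s c ≤ s d * E d := mono le_rfl h
      _ = s d := sE d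
  · exact E_iff.1 h

theorem absorb' {c d : R} (h : s c ≤ E d) : s d * s (st c) = s d := absorb (st_mem_E h)

theorem E_le_E {c d : R} (h : s c ≤ E d) : E c ≤ E d := by
  calc E c ≤ E d * E d := mono h (st_mem_E h)
    _ = E d := EE d

theorem E_le_of_sq {d c : R} (h : s d ≤ s c * s c) : E d ≤ E c := by
  have h2 : s (st d) ≤ s (st c) * s (st c) := by
    rw [s_le, mem_ss] at *
    exact st_m h
  calc E d ≤ (s c * s c) * (s (st c) * s (st c)) := mono h h2
    _ = E c * E c := by simp only [E]; ring
    _ = E c := EE c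

theorem absE {d : R} {S : M R} (h1 : 1 ≤ S) (h : S ≤ E d) : s d * S = s d := by
  apply le_antisymm
  · calc s d * S ≤ s d * E d := mono le_rfl h
      _ = s d := sE d
  · calc s d = s d * 1 := by ring
      _ ≤ _ := mono le_rfl h1

theorem not_self_E {d : R} (hd : len d = 1) (h : s d ≤ E d) : False := by
  have h1 := st_mem_E h
  have h2 : 1 ≤ s d := by
    calc 1 ≤ E d := one_le_E d
      _ = s d * s (st d) := rfl
      _ = s d := absorb h1
  rw [one_eq, s_le_s] at h2
  rw [← h2, len_o] at hd
  omega

theorem trick {d : R} {S : M R} (h : s d ≤ S * E d) : s d ≤ S := by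
  obtain ⟨y, x, hy, hx, hd⟩ := mul_elim h
  have h1 : s y ≤ s d := by
    calc s y ≤ s d * s (st x) := rotl hd
      _ = s d := absorb' hx
  rw [s_le_s] at h1
  rw [← h1]
  exact hy

theorem sq_not {d : R} (hd : len d = 1) (h : s d ≤ s d * s d) : False :=
  not_self_E hd (E_iff.2 h)

theorem spow {d : R} {n : ℕ} (hn : 1 ≤ n) : s d ^ n * E d = s d ^ n := by
  obtain ⟨k, rfl⟩ : ∃ k, n = k + 1 := ⟨n - 1, by omega⟩
  rw [pow_succ, mul_assoc, sE]

theorem pow_coset {d h : R} {n : ℕ} (hn : 1 ≤ n) (hh : s h ≤ s d ^ n) : s d ^ n = s h * E d := by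
  induction n, hn using Nat.le_induction generalizing h with
  | base =>
    rw [pow_one, s_le_s] at hh
    rw [pow_one, hh, sE]
  | succ n hn ih =>
    rw [pow_succ] at hh
    rw [mul_comm] at hh
    obtain ⟨k, hk, hh⟩ := mul_elim_s hh
    rw [pow_succ, ih hk]
    calc s k * E d * s d = (s d * s k) * E d := by ring
      _ = s h * E d * E d := by rw [coset' hh]
      _ = s h * (E d * E d) := by ring
      _ = _ := by rw [EE]

theorem pow_E {d : R} {n : ℕ} (hn : 1 ≤ n) (hh : 1 ≤ s d ^ n) : s d ^ n = E d := by
  rw [one_eq] at hh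
  rw [pow_coset hn hh, ← one_eq, one_mul]

theorem exi (a b : R) : ∃ h, s h ≤ s a * s b := by
  obtain ⟨h, hh⟩ := ex a b
  exact ⟨h, s_le.2 (mem_ss.2 hh)⟩

/-- product of a multiset -/
def P (l : Multiset R) : M R := (l.map s).prod

@[simp] theorem P_zero : P (0 : Multiset R) = 1 := by simp [P]
@[simp] theorem P_cons (g : R) (l : Multiset R) : P (g ::ₘ l) = s g * P l := by simp [P]
@[simp] theorem P_add (l l' : Multiset R) : P (l + l') = P l * P l' := by simp [P]
@[simp] theorem P_rep (g : R) (n : ℕ) : P (Multiset.replicate n g) = s g ^ n := by simp [P]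

/-- all arcs -/
def Arcs (l : Multiset R) : Prop := ∀ g ∈ l, len g = 1

theorem Arcs.cons {g : R} {l : Multiset R} (hg : len g = 1) (hl : Arcs l) : Arcs (g ::ₘ l) := by
  intro x hx
  rcases Multiset.mem_cons.1 hx with rfl | hx
  · exact hg
  · exact hl x hx

theorem Arcs.tail {g : R} {l : Multiset R} (hl : Arcs (g ::ₘ l)) : Arcs l :=
  fun x hx => hl x (Multiset.mem_cons_of_mem hx)

theorem Arcs.rep {g : R} {n : ℕ} (hg : len g = 1) : Arcs (Multiset.replicate n g) := by
  intro x hx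
  rw [Multiset.eq_of_mem_replicate hx]
  exact hg

theorem eq_rep {g : R} {l : Multiset R} (h : ∀ x ∈ l, x = g) : P l = s g ^ Multiset.card l := by
  rw [Multiset.eq_replicate_card.2 h, P_rep, Multiset.card_replicate]

theorem len_le {l : Multiset R} (hl : Arcs l) {h : R} (hh : s h ≤ P l) :
    len h ≤ Multiset.card l := by
  induction l using Multiset.induction_on generalizing h with
  | empty =>
    rw [P_zero, one_eq, s_le_s] at hh
    rw [hh, len_o]
    simp
  | cons g l ih =>
    rw [P_cons] at hh
    obtain ⟨b, hb, hh⟩ := mul_elim_s hh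
    have h1 := ih hl.tail hb
    have h2 := len_add (mem_ss.1 (s_le.1 hh))
    have h3 := hl g (Multiset.mem_cons_self _ _)
    rw [Multiset.card_cons]
    omega

theorem path (h : R) : ∃ l, Arcs l ∧ Multiset.card l = len h ∧ s h ≤ P l := by
  generalize hn : len h = n
  induction n generalizing h with
  | zero =>
    refine ⟨0, fun g hg => by simp at hg, by simp, ?_⟩
    rw [len_zero hn, P_zero]
    exact le_rfl
  | succ n ih =>
    obtain ⟨g, k, hg, hk, hm⟩ := len_succ hn
    obtain ⟨l, h1, h2, h3⟩ := ih k hk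
    refine ⟨g ::ₘ l, h1.cons hg, by simp [h2], ?_⟩
    rw [P_cons]
    exact (s_le.2 (mem_ss.2 hm)).trans (mono le_rfl h3)

/-- return path -/
theorem rpath (h : R) : ∃ l, Arcs l ∧ Multiset.card l = r h ∧ 1 ≤ s h * P l := by
  obtain ⟨l, h1, h2, h3⟩ := path (st h)
  exact ⟨l, h1, h2, one_le_iff.2 h3⟩

/-- walk products -/
def W (n : ℕ) (S : M R) : Prop := ∃ l, Arcs l ∧ Multiset.card l = n ∧ S = P l

theorem W.s {g : R} (hg : len g = 1) : W 1 (s g) :=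
  ⟨{g}, fun x hx => by rw [Multiset.mem_singleton.1 hx]; exact hg, by simp, by simp [P]⟩

theorem W.P {l : Multiset R} (hl : Arcs l) : W (Multiset.card l) (P l) := ⟨l, hl, rfl, rfl⟩

theorem W.mul {n k : ℕ} {S T : M R} (h : W n S) (h' : W k T) : W (n + k) (S * T) := by
  obtain ⟨l, a1, a2, rfl⟩ := h
  obtain ⟨l', b1, b2, rfl⟩ := h'
  refine ⟨l + l', ?_, by simp [a2, b2], by simp⟩
  intro g hg
  rcases Multiset.mem_add.1 hg with hg | hg
  · exact a1 g hg
  · exact b1 g hg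

theorem W.pow {g : R} (hg : len g = 1) (n : ℕ) : W n (Hyp.s g ^ n) :=
  ⟨Multiset.replicate n g, Arcs.rep hg, by simp, by simp⟩

theorem rmin {c : R} {n : ℕ} {S : M R} (h : W n S) (hc : 1 ≤ s c * S) : r c ≤ n := by
  obtain ⟨l, a1, a2, rfl⟩ := h
  have := len_le a1 (one_star hc)
  rw [a2] at this
  exact this

/-- pure -/
def Pur (c : R) : Prop :=
  ∀ l, Arcs l → Multiset.card l = r c → 1 ≤ s c * P l → ∀ g ∈ l, g = c

theorem Pur.eq {c g : R} (hp : Pur c) (hg : len g = 1) {n : ℕ} {S : M R} (h : W n S)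
    (hn : n + 1 = r c) (hc : 1 ≤ s c * (s g * S)) : g = c := by
  obtain ⟨l, a1, a2, rfl⟩ := h
  exact hp (g ::ₘ l) (a1.cons hg) (by simp [a2, hn]) (by simpa using hc) g
    (Multiset.mem_cons_self _ _)

theorem Pur.pow {c : R} (hp : Pur c) : s c ^ (r c + 1) = E c := by
  apply pow_E (by omega)
  obtain ⟨l, h1, h2, h3⟩ := rpath c
  have := eq_rep (hp l h1 h2 h3)
  rw [this, h2] at h3
  rw [pow_succ, mul_comm]
  exact h3

theorem r_pos {c : R} (hc : len c = 1) : 1 ≤ r c := by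
  by_contra h
  have h0 : len (st c) = 0 := by unfold r at h; omega
  have := len_zero h0
  rw [← st_st c, this, st_o, len_o] at hc
  omega

theorem typ {c g : R} (hg : len c = 1) {l : Multiset R} (hl : Arcs l)
    (h : 1 ≤ s c * P (g ::ₘ l)) : r g ≤ Multiset.card l + 1 := by
  apply rmin ((W.P hl).mul (W.s hg)) (c := g)
  rw [P_cons] at h
  convert h using 1
  ring

theorem rlow {c g h : R} (hg : len g = 1) (hh : s h ≤ s c * s g) : r c ≤ r h + 1 := by
  obtain ⟨l, h1, h2, h3⟩ := rpath h
  rw [← h2]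
  apply rmin ((W.P h1).mul (W.s hg)) (c := c)
  calc 1 ≤ s h * P l := h3
    _ ≤ s c * s g * P l := mono hh le_rfl
    _ = _ := by ring

theorem lup {c g h : R} (hc : len c = 1) (hg : len g = 1) (hh : s h ≤ s c * s g) : len h ≤ 2 := by
  have := len_add (mem_ss.1 (s_le.1 hh))
  omega

theorem r_zero {h : R} (hh : len h = 0) : r h = 0 := by
  rw [r, len_zero hh, st_o, len_o]

/-- trichotomy of lengths -/
theorem tri {c g h : R} (hc : len c = 1) (hg : len g = 1) (hh : s h ≤ s c * s g) (hr : 1 ≤ r h) :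
    len h = 1 ∨ len h = 2 := by
  have h1 := lup hc hg hh
  have h2 : len h ≠ 0 := fun h0 => by
    have := r_zero h0
    omega
  omega

/-- the step lemma -/
theorem step {c g : R} (hc : len c = 1) (hg : len g = 1) {n : ℕ} {S : M R} (hS : W n S)
    (hn : n + 1 = r c) (hn1 : 1 ≤ n) (h : 1 ≤ s c * (s g * S)) :
    ∃ h, s h ≤ s c * s g ∧ 1 ≤ s h * S ∧ r h = n ∧ (len h = 1 ∨ len h = 2) := by
  rw [← mul_assoc] at h
  obtain ⟨k, h1, h2, h3⟩ := split h
  have h4 := rlow hg h1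
  have h5 := rmin hS h3
  exact ⟨k, h1, h3, by omega, tri hc hg h1 (by omega)⟩

theorem P_const {c x : R} {l : Multiset R} (h : ∀ g ∈ l, s c * s g = s c * s x) :
    s c * P l = s c * s x ^ Multiset.card l := by
  induction l using Multiset.induction_on with
  | empty => simp
  | cons g l ih =>
    rw [P_cons, Multiset.card_cons, pow_succ]
    have h1 := ih fun y hy => h y (Multiset.mem_cons_of_mem hy)
    have h2 := h g (Multiset.mem_cons_self _ _)
    calc s c * (s g * P l) = s g * (s c * P l) := by ring
      _ = (s c * s g) * s x ^ Multiset.card l := by rw [h1]; ring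
      _ = s c * (s x ^ Multiset.card l * s x) := by rw [h2]; ring

/-- structure of arcs -/
def T (c : R) : Prop :=
  Pur c ∨ ∃ d, len d = 1 ∧ r d + 1 = r c ∧ Pur d ∧ (s d ≤ s c * s c ∨ s c ≤ E d)

theorem one_cE {c g : R} (h : 1 ≤ s c * E g) : s c ≤ E g := by
  have := st_mem_E (one_star h)
  rwa [st_st] at this

theorem cE_one {c g : R} (h : s c ≤ E g) : 1 ≤ s c * E g := one_le_iff.2 (st_mem_E h)

theorem E_walk {c x : R} (hx : len x = 1) {k : ℕ} (hk : s x ^ k = E x) (h : s c ≤ E x) :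
    r c ≤ k := by
  apply rmin (W.pow hx k)
  rw [hk]
  exact cE_one h

theorem eq_st {c d : R} (hc : 2 ≤ r c) (hd : len d = 1) (h : s c ≤ s (st d)) : False := by
  rw [s_le_s] at h
  rw [h, r_st] at hc
  omega

theorem dst_E {d x c : R} (h1 : s x ≤ E d) (h : s x ≤ s c * s d) : s c ≤ s (st d) := by
  calc s c ≤ s x * s (st d) := rotl h
    _ ≤ E d * s (st d) := mono h1 le_rfl
    _ = s (st d) := by rw [← E_st, mul_comm, sE]

theorem caseI {c g : R} (hg : len g = 1) (hlt : r g < r c) (hT : T g)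
    (h : 1 ≤ s c * s g ^ r c) : Pur g ∧ r g + 1 = r c ∧ s c ≤ E g := by
  have hgp := r_pos hg
  rcases hT with hp | ⟨d, hd, hr, hp, hq | hq⟩
  · have hpw := hp.pow
    rcases Nat.lt_or_ge (r g + 1) (r c) with h1 | h1
    · exfalso
      obtain ⟨k, hk⟩ : ∃ k, r c = (k + 1) + (r g + 1) := ⟨r c - r g - 2, by omega⟩
      have h2 : s g ^ r c = s g ^ (k + 1) := by
        rw [hk, pow_add, hpw, spow (by omega)]
      rw [h2] at h
      have := rmin (W.pow hg _) h
      omega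
    · have h2 : r g + 1 = r c := by omega
      rw [← h2, hpw] at h
      exact ⟨hp, h2, one_cE h⟩
  · exfalso
    have := r_pos hd
    obtain ⟨k, hk⟩ : ∃ k, r c = (k + 1) + 2 := ⟨r c - 3, by omega⟩
    have h2 : s g ^ r c = s g ^ (k + 1) * s d := by
      rw [hk, pow_add, pow_two, coset hq, mul_comm (s d), ← mul_assoc, spow (by omega)]
    rw [h2] at h
    have := rmin ((W.pow hg _).mul (W.s hd)) h
    omega
  · exfalso
    have h2 : s g ^ r c ≤ E d := by
      have : ∀ k, s g ^ k ≤ E d := by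
        intro k
        induction k with
        | zero => rw [pow_zero]; exact one_le_E d
        | succ k ih =>
          rw [pow_succ]
          calc _ ≤ E d * E d := mono ih hq
            _ = E d := EE d
      exact this _
    have h3 : 1 ≤ s c * E d := h.trans (mono le_rfl h2)
    have := E_walk hd hp.pow (one_cE h3)
    omega

theorem circC {c d : R} (hc : len c = 1) (hd : len d = 1) (hr : r d + 1 = r c) (hp : Pur d)
    (hq : s d ≤ s c * s c) {l : Multiset R} (hl : Arcs l) (hcard : Multiset.card l = r c)
    (h : 1 ≤ s c * P l) : l = c ::ₘ Multiset.replicate (r d) d := by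
  have hdp := r_pos hd
  have hcd : c ≠ d := by rintro rfl; omega
  have hnE : ¬ s c ≤ E d := fun hE => by
    apply not_self_E hd
    calc s d ≤ s c * s c := hq
      _ ≤ E d * E d := mono hE hE
      _ = E d := EE d
  -- steps
  have key : ∀ g ∈ l, g = c ∨ ∃ F, len F = 2 ∧ r F = r d ∧ s F ≤ s c * s g := by
    intro g hg
    obtain ⟨l', rfl⟩ := Multiset.exists_cons_of_mem hg
    rw [P_cons] at h
    rw [Multiset.card_cons] at hcard
    obtain ⟨F, h1, h2, h3, h4⟩ := step hc (hl g hg) (W.P hl.tail) hcard (by omega) h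
    rcases h4 with h4 | h4
    · left
      have : F = d := uniq (by omega) (by omega)
      subst this
      have : s g ≤ s c := by
        calc s g ≤ s F * s (st c) := rotr h1
          _ ≤ (s c * s c) * s (st c) := mono hq le_rfl
          _ = s c * E c := by rw [E]; ring
          _ = s c := sE c
      exact s_le_s.1 this
    · right
      exact ⟨F, h4, by omega, h1⟩
  by_cases hcl : c ∈ l
  · obtain ⟨l', rfl⟩ := Multiset.exists_cons_of_mem hcl
    have h' := h
    rw [P_cons] at h'
    rw [Multiset.card_cons] at hcard
    obtain ⟨F, h1, h2, h3, h4⟩ := step hc hc (W.P hl.tail) hcard (by omega) h'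
    rcases h4 with h4 | h4
    · have : F = d := uniq (by omega) (by omega)
      subst this
      have h5 := hp l' hl.tail (by omega) h2
      rw [Multiset.eq_replicate_card.2 h5]
      congr 2
      omega
    · exfalso
      have h5 : ∀ g ∈ l', g = c := by
        intro g hg
        rcases key g (Multiset.mem_cons_of_mem hg) with h6 | ⟨F', a1, a2, a3⟩
        · exact h6
        · have : F' = F := uniq (by omega) (by omega)
          subst this
          have h7 := cancelE (same a3 h1)
          rw [mul_comm (E c) (s c), sE] at h7
          have : s g ≤ s c := by
            calc s g = 1 * s g := by ring
              _ ≤ E c * s g := mono (one_le_E c) le_rfl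
              _ = s c := h7
          exact s_le_s.1 this
      have h6 : P l' = s c ^ r d := by rw [eq_rep h5]; congr 1; omega
      obtain ⟨k, hk⟩ : ∃ k, r d = k + 1 := ⟨r d - 1, by omega⟩
      have h7 : 1 ≤ s d * (s c * s c ^ k) := by
        calc 1 ≤ s c * (s c * P l') := h'
          _ = (s c * s c) * s c ^ (k + 1) := by rw [h6, hk]; ring
          _ = s d * (s c ^ (k + 1) * E c) := by rw [coset hq]; ring
          _ = _ := by rw [spow (by omega)]; ring
      exact hcd (hp.eq hc (W.pow hc k) hk.symm h7)
  · exfalso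
    have hdn : 1 ≤ s c * (s d * (s c * s d ^ (r d - 1))) := by
      calc 1 ≤ E d := one_le_E d
        _ = s d ^ (r d + 1) := hp.pow.symm
        _ = s d * s d ^ r d := by ring
        _ ≤ s c * s c * s d ^ r d := mono hq le_rfl
        _ = s c * s c * s d ^ ((r d - 1) + 1) := by rw [Nat.sub_add_cancel hdp]
        _ = _ := by ring
    obtain ⟨F, h1, h2, h3, h4⟩ := step hc hd ((W.s hc).mul (W.pow hd _)) (by omega) (by omega) hdn
    rcases h4 with h4 | h4
    · have : F = d := uniq (by omega) (by omega)
      subst this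
      rw [mul_comm] at h1
      exact hnE (E_iff.2 h1)
    · have h5 : s c * P l = s c * s d ^ Multiset.card l := by
        apply P_const
        intro g hg
        rcases key g hg with rfl | ⟨F', a1, a2, a3⟩
        · exact absurd hg hcl
        · have : F' = F := uniq (by omega) (by omega)
          subst this
          exact same a3 h1
      rw [h5, hcard, ← hr, hp.pow] at h
      exact hnE (one_cE h)

theorem circD {c d : R} (hc : len c = 1) (hd : len d = 1) (hr : r d + 1 = r c) (hp : Pur d)
    (hq : s c ≤ E d) (hT : ∀ g : R, len g = 1 → r g < r c → T g)
    {l : Multiset R} (hl : Arcs l) (hcard : Multiset.card l = r c)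
    (h : 1 ≤ s c * P l) : (∀ g ∈ l, g = c) ∨ (∀ g ∈ l, g = d) := by
  have hdp := r_pos hd
  have hD : d ∈ l → ∀ g ∈ l, g = d := by
    intro hdl
    obtain ⟨l', rfl⟩ := Multiset.exists_cons_of_mem hdl
    rw [P_cons, ← mul_assoc, mul_comm (s c), absorb hq] at h
    rw [Multiset.card_cons] at hcard
    have := hp l' hl.tail (by omega) h
    intro g hg
    rcases Multiset.mem_cons.1 hg with h | h
    · exact h
    · exact this g h
  have key : ∀ g ∈ l, g = d ∨ ∃ F, len F = 2 ∧ r F = r d ∧ s F ≤ s c * s g := by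
    intro g hg
    obtain ⟨l', rfl⟩ := Multiset.exists_cons_of_mem hg
    rw [P_cons] at h
    rw [Multiset.card_cons] at hcard
    obtain ⟨F, h1, h2, h3, h4⟩ := step hc (hl g hg) (W.P hl.tail) hcard (by omega) h
    rcases h4 with h4 | h4
    · left
      have : F = d := uniq (by omega) (by omega)
      subst this
      have : s g ≤ s F := by
        calc s g ≤ s F * s (st c) := rotr h1
          _ = s F := absorb' hq
      exact s_le_s.1 this
    · right
      exact ⟨F, h4, by omega, h1⟩
  by_cases hdl : d ∈ l
  · exact Or.inr (hD hdl)
  by_cases hall : ∀ g ∈ l, g = c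
  · exact Or.inl hall
  right
  push Not at hall
  obtain ⟨g0, hg0, hgc⟩ := hall
  have hle : r g0 ≤ r c := by
    obtain ⟨l', rfl⟩ := Multiset.exists_cons_of_mem hg0
    have := typ hc hl.tail h
    rw [Multiset.card_cons] at hcard
    omega
  have hlt : r g0 < r c := by
    rcases Nat.lt_or_ge (r g0) (r c) with h1 | h1
    · exact h1
    · exact absurd (uniq ((hl g0 hg0).trans hc.symm) (by omega)) hgc
  rcases key g0 hg0 with h1 | ⟨F, f1, f2, f3⟩
  · exact absurd (h1 ▸ hg0) hdl
  have h5 : s c * P l = s c * s g0 ^ Multiset.card l := by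
    apply P_const
    intro g hg
    rcases key g hg with rfl | ⟨F', a1, a2, a3⟩
    · exact absurd hg hdl
    · have : F' = F := uniq (by omega) (by omega)
      subst this
      exact same a3 f3
  rw [h5, hcard] at h
  obtain ⟨_, b2, _⟩ := caseI (hl g0 hg0) hlt (hT g0 (hl g0 hg0) hlt) h
  have : g0 = d := uniq ((hl g0 hg0).trans hd.symm) (by omega)
  exact absurd (this ▸ hg0) hdl

/-- circuits only involve two types -/
theorem circAll {c : R} (hc : len c = 1) (hT : ∀ g : R, len g = 1 → r g ≤ r c → T g)
    {g : R} (hg : len g = 1) {n : ℕ} {S : M R} (hS : W n S) (hn : n + 1 = r c)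
    (h : 1 ≤ s c * (s g * S)) : r g = r c ∨ r g + 1 = r c := by
  obtain ⟨l, a1, a2, rfl⟩ := hS
  have b1 := a1.cons hg
  have b2 : Multiset.card (g ::ₘ l) = r c := by rw [Multiset.card_cons, a2, hn]
  have b3 : 1 ≤ s c * P (g ::ₘ l) := by rwa [P_cons]
  have hm : g ∈ g ::ₘ l := Multiset.mem_cons_self _ _
  rcases hT c hc le_rfl with hp | ⟨d, hd, hr, hp, hq | hq⟩
  · left; rw [hp _ b1 b2 b3 g hm]
  · have := circC hc hd hr hp hq b1 b2 b3
    rw [this] at hm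
    rcases Multiset.mem_cons.1 hm with rfl | hm
    · left; rfl
    · right; rw [Multiset.eq_of_mem_replicate hm]; exact hr
  · rcases circD hc hd hr hp hq (fun g h1 h2 => hT g h1 h2.le) b1 b2 b3 with h1 | h1
    · left; rw [h1 g hm]
    · right; rw [h1 g hm]; exact hr

theorem absorb_pow {c d : R} (h : s c ≤ E d) (k : ℕ) : s d * s c ^ k = s d := by
  induction k with
  | zero => rw [pow_zero, mul_one]
  | succ k ih => rw [pow_succ, ← mul_assoc, ih, absorb h]

theorem caseIIa {c d e : R} (hc : len c = 1) (hd : len d = 1) (he : len e = 1)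
    (hr : r d + 1 = r c) (hp : Pur d) (hde : s d ≤ s c * s e) (hre : r e ≤ r c) :
    s d ≤ s c * s c ∨ s c ≤ E d := by
  by_cases hec : e = c
  · left; rw [hec] at hde; exact hde
  by_cases hed : e = d
  · right; rw [hed, mul_comm] at hde; exact E_iff.2 hde
  have h1 : r e ≠ r c := fun h => hec (uniq (by omega) h)
  have h2 : r e ≠ r d := fun h => hed (uniq (by omega) h)
  have h3 := r_pos he
  obtain ⟨k, hk⟩ : ∃ k, r d = k + 2 := ⟨r d - 2, by omega⟩
  have hone : 1 ≤ s d * (s d * s d ^ (k + 1)) := by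
    calc 1 ≤ E d := one_le_E d
      _ = s d ^ (r d + 1) := hp.pow.symm
      _ = _ := by rw [hk]; ring
  have hC : 1 ≤ s c * (s d * (s e * s d ^ (k + 1))) := by
    calc 1 ≤ s d * (s d * s d ^ (k + 1)) := hone
      _ ≤ (s c * s e) * (s d * s d ^ (k + 1)) := mono hde le_rfl
      _ = _ := by ring
  obtain ⟨F, f1, f2, f3, f4⟩ := step hc hd ((W.s he).mul (W.pow hd (k + 1))) (by omega) (by omega) hC
  rcases f4 with f4 | f4
  · right
    have : F = d := uniq (by omega) (by omega)
    subst this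
    rw [mul_comm] at f1
    exact E_iff.2 f1
  have hC2 : 1 ≤ (s d * s e) * (s c * s d ^ (k + 1)) := by
    convert hC using 1; ring
  obtain ⟨x, x1, x2, x3⟩ := split hC2
  have x4 := rmin ((W.s hc).mul (W.pow hd (k + 1))) x3
  have x5 := rlow he x1
  have x6 := tri hd he x1 (by omega)
  by_cases hx : r x = k + 1
  · obtain ⟨u, u1, u2, u3⟩ := rpath x
    exfalso
    apply hed
    refine hp.eq he (W.P u1) (by omega) ?_
    calc 1 ≤ s x * P u := u3
      _ ≤ s d * s e * P u := mono x1 le_rfl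
      _ = _ := by ring
  rcases x6 with x6 | x6
  · exfalso
    have : x = d := uniq (by omega) (by omega)
    subst this
    have h5 : s c ≤ s x := by
      calc s c ≤ s x * s (st e) := rotl hde
        _ = s x := absorb' (E_iff.2 x1)
    rw [s_le_s] at h5
    subst h5
    omega
  · left
    have : x = F := uniq (by omega) (by omega)
    subst this
    rw [mul_comm] at f1
    have h5 := cancelE (same f1 x1)
    apply trick
    calc s d ≤ s c * s e * 1 := by rw [mul_one]; exact hde
      _ ≤ s c * s e * E d := mono le_rfl (one_le_E d)
      _ = s c * (E d * s e) := by ring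
      _ = s c * s c * E d := by rw [← h5]; ring

theorem caseC {c d e d' : R} (hc : len c = 1) (hd : len d = 1) (he : len e = 1) (hd' : len d' = 1)
    (hr : r d + 1 = r c) (hr' : r d' + 1 = r d) (hp : Pur d') (hq : s d' ≤ s d * s d)
    (hde : s d ≤ s c * s e)
    (hF : ∀ F, len F = 2 → r F = r d → s F ≤ s c * s e → False) : False := by
  have h3 := r_pos hd'
  obtain ⟨j, hj⟩ : ∃ j, r d' = j + 1 := ⟨r d' - 1, by omega⟩
  have hEE : E d' ≤ E d := E_le_of_sq hq
  have hpw : s d' ^ (j + 2) = E d' := by rw [← hp.pow, hj]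
  have hnE : ¬ s d ≤ E d' := fun hE => by
    apply not_self_E hd'
    calc s d' ≤ s d * s d := hq
      _ ≤ E d' * E d' := mono hE hE
      _ = E d' := EE d'
  have hone : 1 ≤ s d * s d * s d' ^ (j + 1) := by
    calc 1 ≤ E d' := one_le_E d'
      _ = s d' ^ (j + 2) := hpw.symm
      _ = s d' * s d' ^ (j + 1) := by ring
      _ ≤ _ := mono hq le_rfl
  have hC0 : 1 ≤ s c * s e * (s d * s d' ^ (j + 1)) := by
    calc 1 ≤ s d * s d * s d' ^ (j + 1) := hone
      _ = s d * (s d * s d' ^ (j + 1)) := by ring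
      _ ≤ (s c * s e) * (s d * s d' ^ (j + 1)) := mono hde le_rfl
  have hC : 1 ≤ s c * (s d * (s e * s d' ^ (j + 1))) := by
    convert hC0 using 1; ring
  obtain ⟨F, f1, f2, f3, f4⟩ := step hc hd ((W.s he).mul (W.pow hd' (j + 1))) (by omega) (by omega) hC
  rcases f4 with f4 | f4
  · have : F = d := uniq (by omega) (by omega)
    subst this
    have hcE : s c ≤ E F := by
      rw [mul_comm] at f1
      exact E_iff.2 f1
    have := circC hd hd' hr' hp hq (l := e ::ₘ Multiset.replicate (j + 1) d')
      (Arcs.cons he (Arcs.rep hd')) (by simp; omega) (by rw [P_cons, P_rep]; exact f2)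
    rw [hj, Multiset.cons_inj_left] at this
    subst this
    have hC1 : 1 ≤ s c * (s d' * (s e * s e * s d' ^ j)) := by
      convert hC using 1; ring
    clear f1 f2 f3 f4
    obtain ⟨F, f1, f2, f3, f4⟩ := step hc hd' (((W.s hd).mul (W.s hd)).mul (W.pow hd' j))
      (by omega) (by omega) hC1
    rcases f4 with f4 | f4
    · have : F = e := uniq (by omega) (by omega)
      subst this
      apply sq_not hd
      calc s F ≤ s c * s d' := f1
        _ ≤ s c * (s F * s F) := mono le_rfl hq
        _ = (s F * s c) * s F := by ring
        _ = s F * s F := by rw [absorb hcE]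
    have key : ∀ k, s k ≤ s e * s e → k = d' ∨ k = F := by
      intro k hk
      have k1 := rlow hd hk
      have k2 : r k ≤ j + 2 := by
        apply rmin ((W.pow hd' j).mul ((W.s hd).mul (W.s hd)))
        calc 1 ≤ s e * s e * s d' ^ (j + 1) := hone
          _ = (s e * E e) * s e * s d' ^ (j + 1) := by rw [sE]
          _ = (s d' * E e) * s e * s e * s d' ^ j := by ring
          _ = (s k * E e) * s e * s e * s d' ^ j := by rw [← coset hq, ← coset hk]
          _ = s k * (s e * E e) * s e * s d' ^ j := by ring
          _ = s k * (s d' ^ j * (s e * s e)) := by rw [sE]; ring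
      have k3 := tri hd hd hk (by omega)
      by_cases hx : r k = j + 1
      · rcases k3 with k3 | k3
        · left
          exact uniq (by omega) (by omega)
        · left
          obtain ⟨u, u1, u2, u3⟩ := rpath k
          have := circC hd hd' hr' hp hq (l := e ::ₘ u)
            (Arcs.cons he u1) (by simp; omega) (by
              rw [P_cons]
              calc 1 ≤ s k * P u := u3
                _ ≤ s e * s e * P u := mono hk le_rfl
                _ = _ := by ring)
          rw [Multiset.cons_inj_right] at this
          rw [this, P_rep, hj] at u3
          have h5 : s d' ≤ s k * E d' := by
            calc s d' = s d' * 1 := by ring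
              _ ≤ s d' * (s k * s d' ^ (j + 1)) := mono le_rfl u3
              _ = s k * s d' ^ (j + 2) := by ring
              _ = _ := by rw [hpw]
          exact (s_le_s.1 (trick h5)).symm
      · rcases k3 with k3 | k3
        · exfalso
          have : k = e := uniq (by omega) (by omega)
          subst this
          exact sq_not hd hk
        · right
          exact uniq (by omega) (by omega)
    obtain ⟨k, hk⟩ := exi F c
    have hk2 : s k ≤ s d' * (s c * s c) := by
      calc s k ≤ s F * s c := hk
        _ ≤ (s c * s d') * s c := mono f1 le_rfl
        _ = _ := by ring
    have hk3 : s k ≤ s e * s e := by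
      calc s k ≤ s d' * (s c * s c) := hk2
        _ ≤ (s e * s e) * (s c * s c) := mono hq le_rfl
        _ = (s e * s c) * (s e * s c) := by ring
        _ = _ := by rw [absorb hcE]
    rcases key k hk3 with rfl | rfl
    · obtain ⟨x, x1, x2⟩ := mul_elim_s hk2
      have x3 := E_iff.2 x2
      have x4 := E_walk hd' hpw x3
      have x5 := rlow hc x1
      rcases tri hc hc x1 (by omega) with x6 | x6
      · have : x = e := uniq (by omega) (by omega)
        subst this
        exact hnE x3
      · have : x = F := uniq (by omega) (by omega)
        subst this
        exact eq_st (by omega) hd' (dst_E x3 f1)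
    · have h6 : s c ≤ E k := E_iff.2 hk
      have h7 : s (st k) ≤ s (st c) * s (st d') := s_le.2 (mem_ss.2 (st_m (mem_ss.1 (s_le.1 f1))))
      have h8 : s c ≤ E d' * E c := by
        calc s c ≤ s k * s (st k) := h6
          _ ≤ (s c * s d') * (s (st c) * s (st d')) := mono f1 h7
          _ = _ := by simp only [E]; ring
      have := E_walk hd' hpw (trick h8)
      omega
  · have hC1 : 1 ≤ s c * (s d' * (s e * s d * s d' ^ j)) := by
      convert hC using 1; ring
    obtain ⟨F', g1, g2, g3, g4⟩ := step hc hd' (((W.s he).mul (W.s hd)).mul (W.pow hd' j))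
      (by omega) (by omega) hC1
    rcases g4 with g4 | g4
    · have : F' = d := uniq (by omega) (by omega)
      subst this
      have := circC hd hd' hr' hp hq (l := e ::ₘ F' ::ₘ Multiset.replicate j d')
        (Arcs.cons he (Arcs.cons hd (Arcs.rep hd'))) (by simp; omega)
        (by simpa [mul_assoc] using g2)
      rw [hj, Multiset.replicate_succ, Multiset.cons_swap, Multiset.cons_inj_right,
        Multiset.cons_inj_left] at this
      subst this
      have h5 : 1 ≤ s F' * s c := by
        calc 1 ≤ s c * s e * (s F' * s e ^ (j + 1)) := hC0
          _ = s c * (s F' * s e ^ (j + 2)) := by ring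
          _ = s c * (s F' * E e) := by rw [hpw]
          _ = s F' * s c := by rw [absE (one_le_E e) hEE]; ring
      have h6 := s_le_s.1 (one_star h5)
      exact eq_st (c := c) (d := F') (by omega) hd (s_le_s.2 h6.symm)
    · have : F' = F := uniq (by omega) (by omega)
      subst this
      have h5 := same f1 g1
      have h6 : 1 ≤ s c * (s e * s d' ^ (j + 2)) := by
        calc 1 ≤ s c * s e * (s d * s d' ^ (j + 1)) := hC0
          _ = (s c * s d) * (s e * s d' ^ (j + 1)) := by ring
          _ = _ := by rw [h5]; ring
      obtain ⟨x, x1, x2, x3, x4⟩ := step hc he (W.pow hd' (j + 2)) (by omega) (by omega) h6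
      rcases x4 with x4 | x4
      · have : x = d := uniq (by omega) (by omega)
        subst this
        rw [hpw] at x2
        exact hnE (one_cE x2)
      · exact hF x x4 (by omega) x1

theorem caseD {c d e d' : R} (hc : len c = 1) (hd : len d = 1) (he : len e = 1) (hd' : len d' = 1)
    (hr : r d + 1 = r c) (hr' : r d' + 1 = r d) (hp : Pur d') (hq : s d ≤ E d')
    (hT : ∀ g : R, len g = 1 → r g < r d → T g)
    (hde : s d ≤ s c * s e) : False := by
  have h3 := r_pos hd'
  obtain ⟨k, hk⟩ : ∃ k, r d' = k + 1 := ⟨r d' - 1, by omega⟩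
  have hpw : s d' ^ (k + 2) = E d' := by rw [← hp.pow, hk]
  have n1 : ¬ s c ≤ E d' := fun h => by
    have := E_walk hd' hpw h
    omega
  have n2 : ¬ s c ≤ E d := fun h => n1 (h.trans (E_le_E hq))
  have n3 : ¬ s d ≤ s c * s d' := fun h => eq_st (by omega) hd' (dst_E hq h)
  have n4 : ¬ s d ≤ s c * s d := fun h => by
    rw [mul_comm] at h
    exact n2 (E_iff.2 h)
  have n5 : d ≠ d' := by rintro rfl; omega
  have N0 : ¬ 1 ≤ s d * (s d * s d ^ (k + 1)) := by
    intro h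
    have hC0 : 1 ≤ s c * s e * (s d * s d ^ (k + 1)) := h.trans (mono hde le_rfl)
    have hC : 1 ≤ s c * (s d * (s e * s d ^ (k + 1))) := by
      convert hC0 using 1; ring
    obtain ⟨F, f1, f2, f3, f4⟩ := step hc hd ((W.s he).mul (W.pow hd (k + 1)))
      (by omega) (by omega) hC
    rcases f4 with f4 | f4
    · have : F = d := uniq (by omega) (by omega)
      subst this
      exact n4 f1
    have hC2 : 1 ≤ (s d * s e) * (s c * s d ^ (k + 1)) := by
      convert hC using 1; ring
    obtain ⟨x, x1, x2, x3⟩ := split hC2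
    have x4 := rmin ((W.s hc).mul (W.pow hd (k + 1))) x3
    have x5 := rlow he x1
    have x6 := tri hd he x1 (by omega)
    have hcc : s d ≤ s c * s c := by
      by_cases hx : r x = k + 1
      · exfalso
        obtain ⟨u, u1, u2, u3⟩ := rpath x
        have h9 := circD hd hd' hr' hp hq hT (l := e ::ₘ u) (Arcs.cons he u1) (by simp; omega) (by
              rw [P_cons]
              calc 1 ≤ s x * P u := u3
                _ ≤ s d * s e * P u := mono x1 le_rfl
                _ = _ := by ring)
        rcases h9 with h9 | h9
        · have := h9 e (Multiset.mem_cons_self _ _)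
          subst this
          exact n4 hde
        · have := h9 e (Multiset.mem_cons_self _ _)
          subst this
          exact n3 hde
      · rcases x6 with x6 | x6
        · exfalso
          have : x = d := uniq (by omega) (by omega)
          subst this
          have h5 : s c ≤ s x := by
            calc s c ≤ s x * s (st e) := rotl hde
              _ = s x := absorb' (E_iff.2 x1)
          rw [s_le_s] at h5
          subst h5
          omega
        · have : x = F := uniq (by omega) (by omega)
          subst this
          rw [mul_comm] at f1
          have h5 := cancelE (same f1 x1)
          apply trick
          calc s d ≤ s c * s e * 1 := by rw [mul_one]; exact hde
            _ ≤ s c * s e * E d := mono le_rfl (one_le_E d)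
            _ = s c * (E d * s e) := by ring
            _ = s c * s c * E d := by rw [← h5]; ring
    obtain ⟨y, hy⟩ := exi c d'
    have y1 := rlow hd' hy
    have y2 : r y ≤ 1 + (k + 1) := by
      apply rmin ((W.s hc).mul (W.pow hd' (k + 1)))
      calc 1 ≤ s d * E d' := cE_one hq
        _ ≤ s c * s c * E d' := mono hcc le_rfl
        _ = s c * s c * s d' ^ (k + 2) := by rw [hpw]
        _ = (s c * s d') * (s c * s d' ^ (k + 1)) := by ring
        _ = (s y * E d') * (s c * s d' ^ (k + 1)) := by rw [coset hy]
        _ = s y * (s c * (s d' ^ (k + 1) * E d')) := by ring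
        _ = _ := by rw [spow (by omega)]
    have y3 := tri hc hd' hy (by omega)
    rcases y3 with y3 | y3
    · have : y = d := uniq (by omega) (by omega)
      subst this
      exact n3 hy
    · have : y = F := uniq (by omega) (by omega)
      subst this
      have h5 := same f1 hy
      have h6 : 1 ≤ s c * (s c * s d') := by
        calc 1 ≤ s d * (s d * s d ^ (k + 1)) := h
          _ ≤ (s c * s c) * (s d * s d ^ (k + 1)) := mono hcc le_rfl
          _ = s c * (s c * s d) * s d ^ (k + 1) := by ring
          _ = s c * (s c * (s d' * s d ^ (k + 1))) := by rw [h5]; ring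
          _ = _ := by rw [absorb_pow hq]
      have := rmin ((W.s hc).mul (W.s hd')) h6
      omega
  have hC : 1 ≤ s c * (s d' * (s e * s d' ^ (k + 1))) := by
    calc 1 ≤ s d * E d' := cE_one hq
      _ ≤ s c * s e * E d' := mono hde le_rfl
      _ = s c * s e * s d' ^ (k + 2) := by rw [hpw]
      _ = _ := by ring
  obtain ⟨F, f1, f2, f3, f4⟩ := step hc hd' ((W.s he).mul (W.pow hd' (k + 1)))
    (by omega) (by omega) hC
  rcases f4 with f4 | f4
  · have : F = d := uniq (by omega) (by omega)
    subst this
    exact n3 f1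
  obtain ⟨x, hx⟩ := exi d d
  have x1 : s x ≤ E d' := by
    calc s x ≤ s d * s d := hx
      _ ≤ E d' * E d' := mono hq hq
      _ = E d' := EE d'
  have x2 := E_walk hd' hpw x1
  have x3 := rlow hd hx
  rcases tri hd hd hx (by omega) with x6 | x6
  · by_cases h : r x = k + 1
    · have : x = d' := uniq (by omega) (by omega)
      subst this
      exact not_self_E hd' x1
    · have : x = d := uniq (by omega) (by omega)
      subst this
      exact sq_not hd hx
  · by_cases h : r x = k + 1
    · obtain ⟨u, u1, u2, u3⟩ := rpath x
      have h8 : 1 ≤ s d * (s d * P u) := by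
        calc 1 ≤ s x * P u := u3
          _ ≤ s d * s d * P u := mono hx le_rfl
          _ = _ := by ring
      have h9 := circD hd hd' hr' hp hq hT (l := d ::ₘ u) (Arcs.cons hd u1) (by simp; omega) (by
            rw [P_cons]; exact h8)
      rcases h9 with h9 | h9
      · have := eq_rep (fun g hg => h9 g (Multiset.mem_cons_of_mem hg))
        rw [this, u2, h] at h8
        exact N0 h8
      · exact n5 (h9 d (Multiset.mem_cons_self _ _))
    · have : x = F := uniq (by omega) (by omega)
      subst this
      exact eq_st (by omega) hd' (dst_E x1 f1)

theorem T_all : ∀ c : R, len c = 1 → T c := by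
  intro c
  generalize hn : r c = n
  induction n using Nat.strong_induction_on generalizing c with
  | _ n ih =>
  intro hc
  subst hn
  have IH : ∀ g : R, len g = 1 → r g < r c → T g := fun g hg hlt => ih (r g) hlt g rfl hg
  by_cases hpc : Pur c
  · exact Or.inl hpc
  unfold Pur at hpc
  push Not at hpc
  obtain ⟨l, hl, hcard, h, g0, hg0, hne⟩ := hpc
  have hle : ∀ g ∈ l, r g ≤ r c := by
    intro g hg
    obtain ⟨l', rfl⟩ := Multiset.exists_cons_of_mem hg
    have := typ hc hl.tail h
    rw [Multiset.card_cons] at hcard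
    omega
  have hlt : r g0 < r c := by
    rcases Nat.lt_or_ge (r g0) (r c) with h1 | h1
    · exact h1
    · exact absurd (uniq ((hl g0 hg0).trans hc.symm) (le_antisymm (hle g0 hg0) h1)) hne
  have hpos := r_pos (hl g0 hg0)
  by_cases hall : ∀ g ∈ l, ∃ F, len F = 2 ∧ r F + 1 = r c ∧ s F ≤ s c * s g
  · obtain ⟨F, f1, f2, f3⟩ := hall g0 hg0
    have h5 : s c * P l = s c * s g0 ^ Multiset.card l := by
      apply P_const
      intro g hg
      obtain ⟨F', a1, a2, a3⟩ := hall g hg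
      have : F' = F := uniq (by omega) (by omega)
      subst this
      exact same a3 f3
    rw [h5, hcard] at h
    obtain ⟨b1, b2, b3⟩ := caseI (hl g0 hg0) hlt (IH g0 (hl g0 hg0) hlt) h
    exact Or.inr ⟨g0, hl g0 hg0, b2, b1, Or.inr b3⟩
  push Not at hall
  obtain ⟨e, he, hF⟩ := hall
  have hee := hl e he
  have hre := hle e he
  obtain ⟨l', rfl⟩ := Multiset.exists_cons_of_mem he
  rw [P_cons] at h
  rw [Multiset.card_cons] at hcard
  obtain ⟨d, d1, d2, d3, d4⟩ := step hc hee (W.P hl.tail) hcard (by omega) h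
  rcases d4 with d4 | d4
  swap
  · exact absurd d1 (hF d d4 (by omega))
  have hr : r d + 1 = r c := by omega
  rcases IH d d4 (by omega) with hp | ⟨d', e1, e2, e3, e4 | e4⟩
  · exact Or.inr ⟨d, d4, hr, hp, caseIIa hc d4 hee hr hp d1 hre⟩
  · exfalso
    exact caseC hc d4 hee e1 hr e2 e3 e4 d1 fun F a1 a2 a3 => hF F a1 (by omega) a3
  · exfalso
    exact caseD hc d4 hee e1 hr e2 e3 e4 (fun g hg h2 => IH g hg (by omega)) d1
theorem fin1 {a b c k : R} (hab : s c ≤ s a * s b) (hne : a ≠ b)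
    (hka : s k ≤ s c * s a) (hkb : s k ≤ s c * s b) : False := by
  have h1 := cancelE (same hka hkb)
  have h2 : s c ≤ s a * s a := by
    apply trick
    calc s c ≤ s a * s b * 1 := by rw [mul_one]; exact hab
      _ ≤ s a * s b * E c := mono le_rfl (one_le_E c)
      _ = s a * (E c * s b) := by ring
      _ = _ := by rw [← h1]; ring
  have h3 : s b ≤ s a := by
    calc s b = 1 * s b := by ring
      _ ≤ E c * s b := mono (one_le_E c) le_rfl
      _ = E c * s a := h1.symm
      _ ≤ E a * s a := mono (E_le_of_sq h2) le_rfl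
      _ = s a := by rw [mul_comm, sE]
  exact hne (s_le_s.1 h3).symm

theorem fin2 {c x y k : R} (hc : len c = 1) (hx : len x = 1) (hcxy : s c ≤ s x * s y)
    (hyc : y ≠ c)
    (hcirc : ∀ (n : ℕ) (S : M R), W n S → n + 1 = r c → 1 ≤ s c * (s x * S) → False)
    (hk : s k ≤ s c * s x) (h2 : 2 ≤ r c) :
    r c ≤ r k ∧ (len k = 1 ∨ len k = 2) ∧ (len k = 1 → r k ≠ r c) := by
  have h3 := rlow hx hk
  refine ⟨?_, tri hc hx hk (by omega), ?_⟩
  · by_contra h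
    obtain ⟨u, u1, u2, u3⟩ := rpath k
    apply hcirc _ _ (W.P u1) (by omega)
    calc 1 ≤ s k * P u := u3
      _ ≤ s c * s x * P u := mono hk le_rfl
      _ = _ := by ring
  · intro h4 h5
    have : k = c := uniq (by omega) h5
    subst this
    have : s y ≤ s k := by
      calc s y ≤ s k * s (st x) := rotr hcxy
        _ = s k := absorb' (E_iff.2 hk)
    exact hyc (s_le_s.1 this)

theorem finish {a b c ka kb : R} (hc : len c = 1) (ha : len a = 1) (hb : len b = 1)
    (hab : s c ≤ s a * s b) (hne : a ≠ b) (hac : a ≠ c) (hbc : b ≠ c) (h2 : 2 ≤ r c)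
    (hca : ∀ (n : ℕ) (S : M R), W n S → n + 1 = r c → 1 ≤ s c * (s a * S) → False)
    (hcb : ∀ (n : ℕ) (S : M R), W n S → n + 1 = r c → 1 ≤ s c * (s b * S) → False)
    (hka : s ka ≤ s c * s a) (hra : r ka ≤ r c)
    (hkb : s kb ≤ s c * s b) (hrb : r kb ≤ r c) : False := by
  obtain ⟨a1, a2, a3⟩ := fin2 hc ha hab hbc hca hka h2
  obtain ⟨b1, b2, b3⟩ := fin2 hc hb (by rw [mul_comm]; exact hab) hac hcb hkb h2
  have : ka = kb := by
    apply uniq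
    · rcases a2 with a2 | a2
      · exact absurd (by omega) (a3 a2)
      · rcases b2 with b2 | b2
        · exact absurd (by omega) (b3 b2)
        · omega
    · omega
  subst this
  exact fin1 hab hne hka hkb

theorem st_pow {d w : R} (hp : Pur d) {i j : ℕ} (hi : 1 ≤ i) (hj : 1 ≤ j) (hij : i + j = r d + 1)
    (hw : s w ≤ s d ^ i) : 1 ≤ s w * s d ^ j := by
  calc 1 ≤ E d := one_le_E d
    _ = s d ^ (i + j) := by rw [hij, hp.pow]
    _ = s d ^ i * s d ^ j := by ring
    _ = s w * (s d ^ j * E d) := by rw [pow_coset hi hw]; ring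
    _ = _ := by rw [spow hj]

theorem B3 {d z c : R} (hd : len d = 1) (hz : len z = 1) (hp : Pur d) {i j k : ℕ} (hi : 1 ≤ i)
    (hj : 1 ≤ j) (hij : i + j = r d + 1) (h : 1 ≤ s d ^ i * E z) (hk : s z ^ k = E z)
    (hcE : s c ≤ E d) (hlt : k < r c) : False := by
  obtain ⟨y, y1, y2, y3⟩ := split h
  obtain ⟨i', rfl⟩ : ∃ i', i = i' + 1 := ⟨i - 1, by omega⟩
  obtain ⟨j', rfl⟩ : ∃ j', j = j' + 1 := ⟨j - 1, by omega⟩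
  have key : ∀ w, s w ≤ s d ^ (i' + 1) → len w = i' + 1 ∧ r w = j' + 1 := by
    intro w hw
    have w0 := st_pow hp hi hj hij hw
    have w1 := rmin (W.pow hd _) w0
    have w2 : len w ≤ i' + 1 := by
      have := len_le (l := Multiset.replicate (i' + 1) d) (Arcs.rep hd) (by rw [P_rep]; exact hw)
      simpa using this
    obtain ⟨l, l1, l2, l3⟩ := path w
    obtain ⟨u, u1, u2, u3⟩ := rpath w
    have w3 : r d ≤ Multiset.card l + j' := by
      apply rmin ((W.P l1).mul (W.pow hd j'))
      calc 1 ≤ s w * s d ^ (j' + 1) := w0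
        _ ≤ P l * s d ^ (j' + 1) := mono l3 le_rfl
        _ = _ := by ring
    have w4 : r d ≤ Multiset.card u + i' := by
      apply rmin ((W.P u1).mul (W.pow hd i'))
      calc 1 ≤ s w * P u := u3
        _ ≤ s d ^ (i' + 1) * P u := mono hw le_rfl
        _ = _ := by ring
    omega
  obtain ⟨w, hw⟩ := exi y c
  have hw2 : s w ≤ s d ^ (i' + 1) := by
    calc s w ≤ s y * s c := hw
      _ ≤ s y * E d := mono le_rfl hcE
      _ = _ := (pow_coset hi y1).symm
  have a1 := key y y1
  have a2 := key w hw2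
  have : w = y := uniq (by omega) (by omega)
  subst this
  have h5 : s c ≤ E z := (E_iff.2 hw).trans (E_le_E (one_cE y3))
  have := E_walk hz hk h5
  omega

theorem mix {d x : R} {u : Multiset R} (h : ∀ g ∈ u, g = d ∨ s d * s g = s d * s x) :
    ∃ i m, i + m = Multiset.card u ∧ s d * P u = s d ^ (i + 1) * s x ^ m := by
  induction u using Multiset.induction_on with
  | empty => exact ⟨0, 0, by simp, by simp⟩
  | cons g u ih =>
    obtain ⟨i, m, h1, h2⟩ := ih fun y hy => h y (Multiset.mem_cons_of_mem hy)
    rw [P_cons, Multiset.card_cons]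
    have h3 : s d * (s g * P u) = s g * (s d ^ (i + 1) * s x ^ m) := by rw [← h2]; ring
    rcases h g (Multiset.mem_cons_self _ _) with rfl | h4
    · exact ⟨i + 1, m, by omega, by rw [h3]; ring⟩
    · refine ⟨i, m + 1, by omega, ?_⟩
      rw [h3]
      calc s g * (s d ^ (i + 1) * s x ^ m) = (s d * s g) * (s d ^ i * s x ^ m) := by ring
        _ = _ := by rw [h4]; ring

theorem pow_le_E {g d : R} (h : s g ≤ E d) (k : ℕ) : s g ^ k ≤ E d := by
  induction k with
  | zero => rw [pow_zero]; exact one_le_E d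
  | succ k ih =>
    rw [pow_succ]
    calc _ ≤ E d * E d := mono ih h
      _ = E d := EE d

theorem B2 {c d x k : R} (hd : len d = 1) (hx : len x = 1) (hp : Pur d) (hcE : s c ≤ E d)
    (hr : r d + 1 = r c) (hxE : ¬ s x ≤ E d) (hlt : r x < r d) (hk : s k ≤ s d * s x)
    (hk2 : len k = 2) (hk3 : r k = r d) : False := by
  have hxp := r_pos hx
  have hxd : x ≠ d := by rintro rfl; omega
  obtain ⟨u, u1, u2, u3⟩ := rpath k
  have u4 : 1 ≤ s d * P u * s x := by
    calc 1 ≤ s k * P u := u3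
      _ ≤ s d * s x * P u := mono hk le_rfl
      _ = _ := by ring
  have key : ∀ g ∈ u, g = d ∨ s d * s g = s d * s x := by
    intro g hg
    have hg1 := u1 g hg
    obtain ⟨u', rfl⟩ := Multiset.exists_cons_of_mem hg
    rw [Multiset.card_cons] at u2
    have h1 : 1 ≤ (s d * s g) * (s x * P u') := by
      rw [P_cons] at u4
      convert u4 using 1; ring
    obtain ⟨h, a1, a2, a3⟩ := split h1
    have a4 := rmin ((W.s hx).mul (W.P u1.tail)) a3
    have a5 := rlow hg1 a1
    by_cases a6 : r h + 1 = r d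
    · left
      obtain ⟨v, v1, v2, v3⟩ := rpath h
      refine hp.eq hg1 (W.P v1) (by omega) ?_
      calc 1 ≤ s h * P v := v3
        _ ≤ s d * s g * P v := mono a1 le_rfl
        _ = _ := by ring
    · right
      rcases tri hd hg1 a1 (by omega) with a7 | a7
      · exfalso
        have : h = d := uniq (by omega) (by omega)
        subst this
        exact hxd (hp.eq hx (W.P u1.tail) (by omega) a3)
      · have : h = k := uniq (by omega) (by omega)
        subst this
        exact same a1 hk
  obtain ⟨i, m, him, hP⟩ := mix key
  rw [hP] at u4
  have hm : 1 ≤ m := by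
    by_contra hm
    obtain rfl : m = 0 := by omega
    have : i + 1 = r d + 1 := by omega
    rw [pow_zero, mul_one, this, hp.pow, mul_comm] at u4
    exact hxE (one_cE u4)
  have h1 : 1 ≤ s d ^ (i + 1) * s x ^ (m + 1) := by
    convert u4 using 1; ring
  rcases T_all x hx with hpx | ⟨x', hx', hr', hp', hq | hq⟩
  · rcases Nat.lt_trichotomy (m + 1) (r x + 1) with h2 | h2 | h2
    · obtain ⟨y, y1, y2, y3⟩ := split h1
      have b1 := st_pow hp (j := m) (by omega) hm (by omega) y1
      have b2 := st_pow hpx (j := r x - m) (by omega) (by omega) (by omega) y2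
      have b3 := one_star b2
      rw [st_st] at b3
      obtain ⟨m', rfl⟩ : ∃ m', m = m' + 1 := ⟨m - 1, by omega⟩
      have b4 : 1 ≤ s d * (s x ^ (r x - (m' + 1)) * s d ^ m') := by
        calc 1 ≤ s y * s d ^ (m' + 1) := b1
          _ ≤ s x ^ (r x - (m' + 1)) * s d ^ (m' + 1) := mono b3 le_rfl
          _ = _ := by ring
      have := rmin ((W.pow hx _).mul (W.pow hd m')) b4
      omega
    · rw [h2, hpx.pow] at h1
      exact B3 hd hx hp (j := m) (by omega) hm (by omega) h1 hpx.pow hcE (by omega)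
    · obtain ⟨q, hq⟩ : ∃ q, m + 1 = (q + 1) + (r x + 1) := ⟨m - r x - 1, by omega⟩
      rw [hq, pow_add (s x), hpx.pow, spow (by omega)] at h1
      have h3 : 1 ≤ s d * (s d ^ i * s x ^ (q + 1)) := by
        convert h1 using 1; ring
      have := rmin ((W.pow hd i).mul (W.pow hx _)) h3
      omega
  · have hx'p := r_pos hx'
    rcases Nat.lt_or_ge m 2 with h2 | h2
    · obtain rfl : m = 1 := by omega
      have h3 : s d ≤ s x * s x := by
        apply trick
        calc s d = s d * 1 := by ring
          _ ≤ s d * (s d ^ (i + 1) * s x ^ (1 + 1)) := mono le_rfl h1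
          _ = s x * s x * s d ^ (i + 1 + 1) := by ring
          _ = _ := by rw [him, u2, hk3, hp.pow]
      obtain ⟨t, ht⟩ : ∃ t, r x' = t + 1 := ⟨r x' - 1, by omega⟩
      have h4 : 1 ≤ s d * (s x * s x * s x' ^ t) := by
        calc 1 ≤ E x' := one_le_E x'
          _ = s x' ^ (t + 2) := by rw [← hp'.pow, ht]
          _ = s x' * s x' ^ (t + 1) := by ring
          _ ≤ s x * s x * s x' ^ (t + 1) := mono hq le_rfl
          _ = s d * E x * s x' ^ t * s x' := by rw [coset h3]; ring
          _ ≤ s d * E x * s x' ^ t * (s x * s x) := mono le_rfl hq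
          _ = s d * (s x * E x) * s x' ^ t * s x := by ring
          _ = _ := by rw [sE]; ring
      have := rmin (((W.s hx).mul (W.s hx)).mul (W.pow hx' t)) h4
      omega
    · obtain ⟨m', rfl⟩ : ∃ m', m = m' + 2 := ⟨m - 2, by omega⟩
      have h3 : 1 ≤ s d * (s x' * (s d ^ i * s x ^ (m' + 1))) := by
        calc 1 ≤ s d ^ (i + 1) * s x ^ (m' + 2 + 1) := h1
          _ = s d ^ (i + 1) * s x ^ (m' + 1) * (s x * s x) := by ring
          _ = s d ^ (i + 1) * (s x ^ (m' + 1) * E x) * s x' := by rw [coset hq]; ring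
          _ = _ := by rw [spow (by omega)]; ring
      have := hp.eq hx' ((W.pow hd i).mul (W.pow hx (m' + 1))) (by omega) h3
      subst this
      omega
  · have h2 : 1 ≤ s d ^ (i + 1) * E x' := h1.trans (mono le_rfl (pow_le_E hq _))
    exact B3 hd hx' hp (j := m) (by omega) hm (by omega) h2 hp'.pow hcE (by omega)

theorem B1 {c d x y k : R} (hc : len c = 1) (hd : len d = 1) (hx : len x = 1) (hy : len y = 1)
    (hp : Pur d) (hcE : s c ≤ E d)
    (hr : r d + 1 = r c) (hxE : ¬ s x ≤ E d) (hlt : r x < r d) (hcxy : s c ≤ s x * s y)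
    (hk : s k ≤ s d * s x) : len k = 2 ∧ r k = r c := by
  have hxp := r_pos hx
  have hxd : x ≠ d := by rintro rfl; omega
  have h1 : r k ≤ r d + 1 := by
    apply rmin ((W.pow hd (r d)).mul (W.s hy))
    calc 1 ≤ s c * E d := cE_one hcE
      _ ≤ s x * s y * E d := mono hcxy le_rfl
      _ = s x * s y * s d ^ (r d + 1) := by rw [hp.pow]
      _ = (s d * s x) * s d ^ (r d) * s y := by ring
      _ = s k * (s d ^ (r d) * E d) * s y := by rw [coset' hk]; ring
      _ = _ := by rw [spow (by omega)]; ring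
  have h2 := rlow hx hk
  have h3 : r k + 1 ≠ r d := by
    intro h3
    obtain ⟨u, u1, u2, u3⟩ := rpath k
    apply hxd
    refine hp.eq hx (W.P u1) (by omega) ?_
    calc 1 ≤ s k * P u := u3
      _ ≤ s d * s x * P u := mono hk le_rfl
      _ = _ := by ring
  rcases tri hd hx hk (by omega) with h4 | h4
  · exfalso
    by_cases h5 : r k = r d
    · have : k = d := uniq (by omega) (by omega)
      subst this
      exact hxE (E_iff.2 hk)
    · have : k = c := uniq (by omega) (by omega)
      subst this
      have h6 : s x ≤ s (st d) := by
        calc s x ≤ s k * s (st d) := rotr hk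
          _ ≤ E d * s (st d) := mono hcE le_rfl
          _ = s (st d) := by rw [← E_st, mul_comm, sE]
      have : len x = r d := congrArg len (s_le_s.1 h6)
      omega
  · refine ⟨h4, ?_⟩
    by_contra h5
    exact B2 hd hx hp hcE hr hxE hlt hk h4 (by omega)

theorem B4 {c d x y k : R} (hc : len c = 1) (hd : len d = 1) (hx : len x = 1) (hy : len y = 1)
    (hp : Pur d) (hcE : s c ≤ E d)
    (hr : r d + 1 = r c) (hxE : ¬ s x ≤ E d) (hlt : r x < r d) (hlt' : r y < r d)
    (hcxy : s c ≤ s x * s y) (hyc : y ≠ c)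
    (hcirc : ∀ (n : ℕ) (S : M R), W n S → n + 1 = r c → 1 ≤ s c * (s x * S) → False)
    (hk : s k ≤ s c * s x) : len k = 2 ∧ r k = r c + 1 := by
  have hxp := r_pos hx
  obtain ⟨a1, a2, a3⟩ := fin2 hc hx hcxy hyc hcirc hk (by omega)
  have h0 : 1 ≤ s k * (s y * s d ^ (r d + 1)) := by
    calc (1 : M R) = 1 * 1 := by ring
      _ ≤ (s c * E d) * (s c * E d) := mono (cE_one hcE) (cE_one hcE)
      _ ≤ (s c * E d) * ((s x * s y) * E d) := mono le_rfl (mono hcxy le_rfl)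
      _ = (s c * s x) * s y * (E d * E d) := by ring
      _ = s k * E c * s y * E d := by rw [coset' hk, EE]
      _ ≤ s k * E d * s y * E d := mono (mono (mono le_rfl (E_le_E hcE)) le_rfl) le_rfl
      _ = s k * s y * (E d * E d) := by ring
      _ = _ := by rw [EE, hp.pow]; ring
  have h1 := rmin ((W.s hy).mul (W.pow hd (r d + 1))) h0
  have h2 : len k = 2 := by
    rcases a2 with a2 | a2
    · exfalso
      have h3 := a3 a2
      have := circAll a2 (fun g hg _ => T_all g hg) hy (W.pow hd (r d + 1)) (by omega) h0
      omega
    · exact a2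
  refine ⟨h2, ?_⟩
  by_contra h3
  obtain ⟨Y, hY⟩ := exi d x
  have hY2 := B1 hc hd hx hy hp hcE hr hxE hlt hcxy hY
  have : Y = k := uniq (by omega) (by omega)
  subst this
  have h4 : s c * s x = s d * s x := by rw [coset hk, coset hY]
  have h5 : s d * (s d * s x) = s d * s x := by
    calc s d * (s d * s x) = (s d * s c) * s x := by rw [← h4]; ring
      _ = _ := by rw [absorb hcE]
  have h6 : ∀ i, s d ^ (i + 1) * s x = s d * s x := by
    intro i
    induction i with
    | zero => simp
    | succ i ih => rw [pow_succ', mul_assoc, ih, h5]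
  have h7 : s x ≤ s d * s x := by
    calc s x = 1 * s x := by ring
      _ ≤ E d * s x := mono (one_le_E d) le_rfl
      _ = _ := by rw [← hp.pow, h6]
  have := B1 hc hd hx hy hp hcE hr hxE hlt hcxy h7
  omega

theorem cor_lt {a b c : R} (ha : len a = 1) (hb : len b = 1) (hc : len c = 1)
    (hab : s c ≤ s a * s b) (h1 : r a < r b) (h2 : r b < r c) : False := by
  have hap := r_pos ha
  have hne : a ≠ b := by rintro rfl; omega
  have hac : a ≠ c := by rintro rfl; omega
  have hbc : b ≠ c := by rintro rfl; omega
  have hba : s c ≤ s b * s a := by rw [mul_comm]; exact hab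
  rcases T_all c hc with hp | ⟨d, hd, hr, hp, hq | hq⟩
  · have h3 : 1 ≤ s c * s c * s c ^ (r c - 1) := by
      calc 1 ≤ E c := one_le_E c
        _ = s c ^ (r c - 1 + 2) := by rw [← hp.pow]; congr 1; omega
        _ = _ := by ring
    have g : ∀ x y : R, len y = 1 → s c ≤ s x * s y → ∃ k, s k ≤ s c * s x ∧ r k ≤ r c := by
      intro x y hy hxy
      have h4 : 1 ≤ s c * s x * (s y * s c ^ (r c - 1)) := by
        calc 1 ≤ s c * s c * s c ^ (r c - 1) := h3
          _ ≤ s c * (s x * s y) * s c ^ (r c - 1) := mono (mono le_rfl hxy) le_rfl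
          _ = _ := by ring
      obtain ⟨k, k1, k2, k3⟩ := split h4
      have := rmin ((W.s hy).mul (W.pow hc (r c - 1))) k3
      exact ⟨k, k1, by omega⟩
    obtain ⟨ka, ka1, ka2⟩ := g a b hb hab
    obtain ⟨kb, kb1, kb2⟩ := g b a ha hba
    exact finish hc ha hb hab hne hac hbc (by omega)
      (fun n S hS hn h => hac (hp.eq ha hS hn h)) (fun n S hS hn h => hbc (hp.eq hb hS hn h))
      ka1 ka2 kb1 kb2
  · have hbd : b ≠ d := by
      rintro rfl
      have h5 : s a ≤ s (st c) := by
        calc s a ≤ s c * s (st b) := rotl hab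
          _ ≤ (s b * s (st c)) * s (st b) := mono (rotl hq) le_rfl
          _ = s (st c) * E b := by rw [E]; ring
          _ ≤ s (st c) * E c := mono le_rfl (E_le_of_sq hq)
          _ = s (st c) := by rw [← E_st, sE]
      have : len a = r c := congrArg len (s_le_s.1 h5)
      omega
    have had : a ≠ d := by rintro rfl; omega
    have h3 : 1 ≤ s c * s c * s d ^ r d := by
      calc 1 ≤ E d := one_le_E d
        _ = s d * s d ^ r d := by rw [← hp.pow]; ring
        _ ≤ _ := mono hq le_rfl
    have g : ∀ x y : R, len y = 1 → s c ≤ s x * s y → ∃ k, s k ≤ s c * s x ∧ r k ≤ r c := by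
      intro x y hy hxy
      have h4 : 1 ≤ s c * s x * (s y * s d ^ r d) := by
        calc 1 ≤ s c * s c * s d ^ r d := h3
          _ ≤ s c * (s x * s y) * s d ^ r d := mono (mono le_rfl hxy) le_rfl
          _ = _ := by ring
      obtain ⟨k, k1, k2, k3⟩ := split h4
      have := rmin ((W.s hy).mul (W.pow hd _)) k3
      exact ⟨k, k1, by omega⟩
    have circ : ∀ x : R, len x = 1 → x ≠ c → x ≠ d → ∀ (n : ℕ) (S : M R), W n S → n + 1 = r c →
        1 ≤ s c * (s x * S) → False := by
      rintro x hx hxc hxd n _ ⟨l, l1, l2, rfl⟩ hn h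
      have := circC hc hd hr hp hq (l := x ::ₘ l) (l1.cons hx) (by simp; omega) (by simpa using h)
      have hm : x ∈ x ::ₘ l := Multiset.mem_cons_self _ _
      rw [this] at hm
      rcases Multiset.mem_cons.1 hm with h5 | h5
      · exact hxc h5
      · exact hxd (Multiset.eq_of_mem_replicate h5)
    obtain ⟨ka, ka1, ka2⟩ := g a b hb hab
    obtain ⟨kb, kb1, kb2⟩ := g b a ha hba
    exact finish hc ha hb hab hne hac hbc (by omega) (circ a ha hac had) (circ b hb hbc hbd)
      ka1 ka2 kb1 kb2
  · have hbd : b ≠ d := by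
      rintro rfl
      have h5 : s a ≤ s (st b) := by
        calc s a ≤ s c * s (st b) := rotl hab
          _ ≤ E b * s (st b) := mono hq le_rfl
          _ = s (st b) := by rw [← E_st, mul_comm, sE]
      have : len a = r b := congrArg len (s_le_s.1 h5)
      omega
    have had : a ≠ d := by rintro rfl; omega
    have circ : ∀ x : R, len x = 1 → x ≠ c → x ≠ d → ∀ (n : ℕ) (S : M R), W n S → n + 1 = r c →
        1 ≤ s c * (s x * S) → False := by
      rintro x hx hxc hxd n _ ⟨l, l1, l2, rfl⟩ hn h
      have := circD hc hd hr hp hq (fun g hg _ => T_all g hg) (l := x ::ₘ l) (l1.cons hx)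
        (by simp; omega) (by simpa using h)
      have hm : x ∈ x ::ₘ l := Multiset.mem_cons_self _ _
      rcases this with h5 | h5
      · exact hxc (h5 x hm)
      · exact hxd (h5 x hm)
    have hbd2 : r b ≠ r d := fun h => hbd (uniq (by omega) h)
    obtain ⟨ka, ka1⟩ := exi c a
    obtain ⟨kb, kb1⟩ := exi c b
    have hE : s a ≤ E d ↔ s b ≤ E d := by
      constructor
      · intro h
        calc s b ≤ s c * s (st a) := rotr hab
          _ ≤ E d * E d := mono hq (st_mem_E h)
          _ = E d := EE d
      · intro h
        calc s a ≤ s c * s (st b) := rotl hab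
          _ ≤ E d * E d := mono hq (st_mem_E h)
          _ = E d := EE d
    by_cases haE : s a ≤ E d
    · have hbE := hE.1 haE
      have wa := E_walk hd hp.pow (ka1.trans ((mono hq haE).trans (EE d).le))
      have wb := E_walk hd hp.pow (kb1.trans ((mono hq hbE).trans (EE d).le))
      exact finish hc ha hb hab hne hac hbc (by omega) (circ a ha hac had) (circ b hb hbc hbd)
        ka1 (by omega) kb1 (by omega)
    · have hbE : ¬ s b ≤ E d := fun h => haE (hE.2 h)
      have wa := B4 hc hd ha hb hp hq hr haE (by omega) (by omega) hab hbc (circ a ha hac had) ka1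
      have wb := B4 hc hd hb ha hp hq hr hbE (by omega) (by omega) hba hac (circ b hb hbc hbd) kb1
      have : ka = kb := uniq (by omega) (by omega)
      subst this
      exact fin1 hab hne ka1 kb1

theorem cor_aux {a b c : R} (ha : len a = 1) (hb : len b = 1) (hc : len c = 1)
    (hab : s c ≤ s a * s b) (h1 : r a < r b) (h2 : r c ≠ r a) (h3 : r c ≠ r b) : False := by
  have h4 := rlow ha (show s c ≤ s b * s a by rw [mul_comm]; exact hab)
  by_cases h5 : r b = r c + 1
  · obtain ⟨u, u1, u2, u3⟩ := rpath c
    have := circAll hb (fun g hg _ => T_all g hg) ha (W.P u1) (by omega) (by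
      calc 1 ≤ s c * P u := u3
        _ ≤ s a * s b * P u := mono hab le_rfl
        _ = s b * (s a * P u) := by ring)
    omega
  · exact cor_lt ha hb hc hab h1 (by omega)

theorem cor {a b c : R} (ha : len a = 1) (hb : len b = 1) (hc : len c = 1)
    (hab : m a b c) (h1 : r a ≠ r b) : r c = r a ∨ r c = r b := by
  have h : s c ≤ s a * s b := s_le.2 (mem_ss.2 hab)
  by_contra hcon
  push Not at hcon
  rcases Nat.lt_or_gt_of_ne h1 with h2 | h2
  · exact cor_aux ha hb hc h h2 hcon.1 hcon.2
  · exact cor_aux hb ha hc (by rw [mul_comm]; exact h) h2 hcon.2 hcon.1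

end Hyp

namespace CTWDR

theorem walk_trans {V : Type*} {adj : V → V → Prop} {x y z : V} {n k : ℕ}
    (h1 : HasWalk adj x y n) (h2 : HasWalk adj y z k) : HasWalk adj x z (n + k) := by
  obtain ⟨f, f0, fn, hf⟩ := h1
  obtain ⟨g, g0, gk, hg⟩ := h2
  refine ⟨fun i => if i ≤ n then f i else g (i - n), by simp [f0], ?_, ?_⟩
  · by_cases hk : k = 0
    · subst hk
      simp [fn, ← gk, g0]
    · have : ¬ (n + k ≤ n) := by omega
      simp only [this, if_false, Nat.add_sub_cancel_left, gk]
  · intro i hi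
    by_cases h : i < n
    · have h' : i ≤ n := h.le
      have h'' : i + 1 ≤ n := h
      simp only [h', h'', if_true]
      exact hf i h
    · have h'' : ¬ (i + 1 ≤ n) := by omega
      have hg' := hg (i - n) (by omega)
      rw [show i - n + 1 = i + 1 - n by omega] at hg'
      by_cases h3 : i ≤ n
      · have : i = n := by omega
        subst this
        simp only [le_refl, h'', if_true, if_false]
        rw [Nat.sub_self, g0] at hg'
        rw [fn]
        exact hg'
      · simp only [h3, h'', if_false]
        exact hg'

theorem dd_le {V : Type*} {adj : V → V → Prop} {x y : V} {n : ℕ}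
    (h1 : HasWalk adj x y n) : ddist adj x y ≤ n := Nat.sInf_le h1

variable {V : Type*} [Fintype V] (G : CTWDR V)

theorem dd_walk (x y : V) : HasWalk G.adj x y (ddist G.adj x y) := Nat.sInf_mem (G.strong x y)

theorem dd_tri (x y z : V) : ddist G.adj x z ≤ ddist G.adj x y + ddist G.adj y z :=
  dd_le (walk_trans (G.dd_walk x y) (G.dd_walk y z))

theorem dd_self (x : V) : ddist G.adj x x = 0 := by
  have : HasWalk G.adj x x 0 := ⟨fun _ => x, rfl, rfl, fun i hi => by omega⟩
  have := dd_le this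
  omega

theorem dd_zero {x y : V} (h : ddist G.adj x y = 0) : x = y := by
  obtain ⟨f, f0, fn, _⟩ := G.dd_walk x y
  rw [h] at fn
  rw [← f0, fn]

theorem dd_succ {x y : V} {n : ℕ} (h : ddist G.adj x y = n + 1) :
    ∃ z, ddist G.adj x z = 1 ∧ ddist G.adj z y = n := by
  obtain ⟨f, f0, fn, hf⟩ := G.dd_walk x y
  rw [h] at fn hf
  have h1 : HasWalk G.adj x (f 1) 1 := ⟨f, f0, rfl, fun i hi => hf i (by omega)⟩
  have h2 : HasWalk G.adj (f 1) y n :=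
    ⟨fun i => f (i + 1), rfl, fn, fun i hi => hf (i + 1) (by omega)⟩
  have h3 := dd_le h1
  have h4 := dd_le h2
  have h5 := G.dd_tri x (f 1) y
  exact ⟨f 1, by omega, by omega⟩

theorem t_swap (x y : V) : tdist G.adj y x = (tdist G.adj x y).swap := rfl

theorem t_self (x : V) : tdist G.adj x x = (0, 0) := by
  rw [tdist, dd_self]

theorem transfer {i j : ℕ × ℕ} {x y z x' y' : V} (h : tdist G.adj x y = tdist G.adj x' y')
    (h1 : tdist G.adj x z = i) (h2 : tdist G.adj z y = j) :
    ∃ z', tdist G.adj x' z' = i ∧ tdist G.adj z' y' = j := by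
  have h3 := G.wdr i j x y x' y' h
  have h4 : Set.ncard {z : V | tdist G.adj x z = i ∧ tdist G.adj z y = j} ≠ 0 :=
    Set.ncard_ne_zero_of_mem (a := z) ⟨h1, h2⟩ (Set.toFinite _)
  rw [h3] at h4
  exact Set.nonempty_of_ncard_ne_zero h4

theorem comm_t {i j : ℕ × ℕ} {x y z : V}
    (h1 : tdist G.adj x z = i) (h2 : tdist G.adj z y = j) :
    ∃ z', tdist G.adj x z' = j ∧ tdist G.adj z' y = i := by
  have h3 := G.comm i j x y
  have h4 : Set.ncard {z : V | tdist G.adj x z = i ∧ tdist G.adj z y = j} ≠ 0 :=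
    Set.ncard_ne_zero_of_mem (a := z) ⟨h1, h2⟩ (Set.toFinite _)
  rw [h3] at h4
  exact Set.nonempty_of_ncard_ne_zero h4

theorem pnum_eq {h i j : ℕ × ℕ} {x y : V} (hxy : tdist G.adj x y = h) :
    pnum G.adj h i j = Set.ncard {z : V | tdist G.adj x z = i ∧ tdist G.adj z y = j} := by
  rw [pnum]
  have : {n | ∃ x y : V, tdist G.adj x y = h ∧
      n = Set.ncard {z : V | tdist G.adj x z = i ∧ tdist G.adj z y = j}} =
      {Set.ncard {z : V | tdist G.adj x z = i ∧ tdist G.adj z y = j}} := by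
    ext n
    simp only [Set.mem_setOf_eq, Set.mem_singleton_iff]
    constructor
    · rintro ⟨x', y', h1, rfl⟩
      exact G.wdr i j x' y' x y (h1.trans hxy.symm)
    · rintro rfl
      exact ⟨x, y, hxy, rfl⟩
  rw [this, csSup_singleton]

theorem thick_t {a : ℕ × ℕ} {x y z w : V} (h1 : tdist G.adj x z = a)
    (h2 : tdist G.adj z w = a) (h3 : tdist G.adj w y = a.swap) : tdist G.adj x y = a := by
  have e1 : pnum G.adj (tdist G.adj z y) a a.swap ≠ 0 := by
    rw [G.pnum_eq rfl]
    exact Set.ncard_ne_zero_of_mem (a := w) ⟨h2, h3⟩ (Set.toFinite _)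
  have e2 := ((G.thick (tdist G.adj z y) a).2.resolve_left e1)
  rw [kval, G.pnum_eq rfl, G.pnum_eq (G.t_self z), G.comm, G.comm a] at e2
  have e3 : {u : V | tdist G.adj z u = a.swap ∧ tdist G.adj u y = a} ⊆
      {u : V | tdist G.adj z u = a.swap ∧ tdist G.adj u z = a} := by
    rintro u ⟨u1, u2⟩
    refine ⟨u1, ?_⟩
    rw [G.t_swap z u, u1, Prod.swap_swap]
  have e4 := Set.eq_of_subset_of_ncard_le e3 e2.ge (Set.toFinite _)
  have e5 : x ∈ {u : V | tdist G.adj z u = a.swap ∧ tdist G.adj u z = a} :=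
    ⟨by rw [G.t_swap x z, h1], h1⟩
  rw [← e4] at e5
  exact e5.2

/-- The relations of `G` as an abstract hypergroup. -/
@[reducible] def mkHyp (v : V) : Hyp {i : ℕ × ℕ // Attained G.adj i} where
  m a b h := ∃ x y z, tdist G.adj x y = h.1 ∧ tdist G.adj x z = a.1 ∧ tdist G.adj z y = b.1
  o := ⟨(0, 0), v, v, G.t_self v⟩
  st a := ⟨a.1.swap, by
    obtain ⟨x, y, h⟩ := a.2
    exact ⟨y, x, by rw [G.t_swap x y, h]⟩⟩
  len a := a.1.1
  m_comm := by
    rintro a b h ⟨x, y, z, h1, h2, h3⟩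
    obtain ⟨z', h4, h5⟩ := G.comm_t h2 h3
    exact ⟨x, y, z', h1, h4, h5⟩
  m_assoc := by
    rintro a b c h k ⟨x', y', z', g1, g2, g3⟩ ⟨x, y, z, h1, h2, h3⟩
    obtain ⟨w, w1, w2⟩ := G.transfer (g1.trans h2.symm) g2 g3
    exact ⟨⟨tdist G.adj w y, w, y, rfl⟩, ⟨w, y, z, rfl, w2, h3⟩, ⟨x, y, w, h1, w1, rfl⟩⟩
  one_m := by
    intro a h
    constructor
    · rintro ⟨x, y, z, h1, h2, h3⟩
      have : x = z := G.dd_zero (congrArg Prod.fst h2)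
      subst this
      exact Subtype.ext (h1.symm.trans h3)
    · rintro rfl
      obtain ⟨x, y, hh⟩ := h.2
      exact ⟨x, y, x, hh, G.t_self x, hh⟩
  st_st a := Subtype.ext (Prod.swap_swap _)
  rot := by
    rintro a b h ⟨x, y, z, h1, h2, h3⟩
    exact ⟨x, z, y, h2, h1, by rw [G.t_swap z y, h3]⟩
  thick := by
    rintro a e h ⟨x', y', z', g1, g2, g3⟩ ⟨x, y, z, h1, h2, h3⟩
    obtain ⟨w, w1, w2⟩ := G.transfer (g1.trans h3.symm) g2 g3
    exact Subtype.ext (h1.symm.trans (G.thick_t h2 w1 w2))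
  ex := by
    intro a b
    obtain ⟨x, z, h1⟩ := a.2
    obtain ⟨u, w, h2⟩ := b.2
    obtain ⟨y, h3, -⟩ := G.transfer (x := u) (y := u) (z := w) (x' := z) (y' := z)
      (by rw [G.t_self, G.t_self]) h2 rfl
    exact ⟨⟨tdist G.adj x y, x, y, rfl⟩, x, y, z, rfl, h1, h3⟩
  len_add := by
    rintro a b h ⟨x, y, z, h1, h2, h3⟩
    rw [← h1, ← h2, ← h3]
    exact G.dd_tri x z y
  len_o := rfl
  len_zero := by
    intro a h
    obtain ⟨x, y, h1⟩ := a.2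
    rw [← h1] at h
    have : x = y := G.dd_zero h
    subst this
    rw [G.t_self] at h1
    exact Subtype.ext h1.symm
  len_succ := by
    intro h n hn
    obtain ⟨x, y, h1⟩ := h.2
    rw [← h1] at hn
    obtain ⟨z, z1, z2⟩ := G.dd_succ hn
    exact ⟨⟨tdist G.adj x z, x, z, rfl⟩, ⟨tdist G.adj z y, z, y, rfl⟩, z1, z2, x, y, z, h1, rfl, rfl⟩
  lext := by
    intro a b h1 h2
    exact Subtype.ext (Prod.ext h1 h2)

end CTWDR

theorem stmt10 {V : Type*} [Fintype V] (G : CTWDR V) (q s t : ℕ) (hst : s ≠ t)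
    (h : pnum G.adj (1, q - 1) (1, s - 1) (1, t - 1) ≠ 0) :
    q = s ∨ q = t := by
  have hx : ∃ x y : V, tdist G.adj x y = (1, q - 1) := by
    by_contra hcon
    push Not at hcon
    apply h
    rw [pnum]
    have : {n | ∃ x y : V, tdist G.adj x y = (1, q - 1) ∧
      n = Set.ncard {z : V | tdist G.adj x z = (1, s - 1) ∧ tdist G.adj z y = (1, t - 1)}} = ∅ := by
      ext n
      simp only [Set.mem_setOf_eq, Set.mem_empty_iff_false, iff_false]
      rintro ⟨x, y, h1, -⟩
      exact hcon x y h1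
    rw [this]
    exact csSup_empty
  obtain ⟨x, y, hxy⟩ := hx
  rw [G.pnum_eq hxy] at h
  obtain ⟨z, z1, z2⟩ := Set.nonempty_of_ncard_ne_zero h
  have pos : ∀ (u v : V) (k : ℕ), tdist G.adj u v = (1, k - 1) → 2 ≤ k := by
    intro u v k hk
    by_contra hlt
    have h0 : ddist G.adj v u = 0 := by
      have : ddist G.adj v u = k - 1 := congrArg Prod.snd hk
      omega
    have h1 : ddist G.adj u v = 1 := congrArg Prod.fst hk
    have := G.dd_zero h0
    subst this
    rw [G.dd_self] at h1
    omega
  have p1 := pos _ _ _ hxy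
  have p2 := pos _ _ _ z1
  have p3 := pos _ _ _ z2
  letI := G.mkHyp x
  have key := Hyp.cor (a := (⟨(1, s - 1), x, z, z1⟩ : {i : ℕ × ℕ // Attained G.adj i}))
    (b := ⟨(1, t - 1), z, y, z2⟩) (c := ⟨(1, q - 1), x, y, hxy⟩) rfl rfl rfl
    ⟨x, y, z, hxy, z1, z2⟩ (by
      change s - 1 ≠ t - 1
      omega)
  change q - 1 = s - 1 ∨ q - 1 = t - 1 at key
  omega
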